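/- Let α ∈ (0,1), m = [1/α] + 1, s, j ∈ ℤ⁺ with s − j + 1 ∈ ℤ⁺ and s − 1 ≥ (2/α)j + 3j, and q ∈ (1,2]. There exists C > 0 such that for every T > 0, every λ > 0, and every sufficiently regular u : ℝ × [0,T] → ℝ satisfying ⟨x⟩^m |u(t,x)| ≥ λ/2 for all (t,x) ∈ [0,T] × ℝ, one has ‖ ∂_x^{s−j+1} ( |u|^α ∂_x^{2j−1} u ) ‖_{L_x^q L_T^2} ≤ C ‖u‖_{X_T}^{α+1} + C T^{1/2} λ^{α−1} ‖u‖_{X_T}^2 + C T^{1/2} λ^{α−(s−j+1)} ‖u‖_{X_T}^{s−j+2}. -/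

import Mathlib

open MeasureTheory Filter Set
open scoped ENNReal NNReal

noncomputable section

/-- Japanese bracket `⟨x⟩ = (1+x²)^{1/2}`. -/
def jap (x : ℝ) : ℝ := Real.sqrt (1 + x ^ 2)

/-- `L²(ℝ)` norm, valued in `ℝ≥0∞`. -/
def eL2 (g : ℝ → ℝ) : ℝ≥0∞ := eLpNorm g 2 volume

/-- `L^∞(ℝ)` norm, valued in `ℝ≥0∞`. -/
def eLinf (g : ℝ → ℝ) : ℝ≥0∞ := eLpNorm g ⊤ volume

/-- Integer Sobolev `H^s(ℝ)` norm (sum of `L²` norms of derivatives up to order `s`). -/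
def eHs (s : ℕ) (g : ℝ → ℝ) : ℝ≥0∞ := ∑ k ∈ Finset.range (s + 1), eL2 (iteratedDeriv k g)

/-- `sup_{0 ≤ t ≤ T}` of a time-dependent norm. -/
def eLTinf (T : ℝ) (N : ℝ → ℝ≥0∞) : ℝ≥0∞ := ⨆ t : Set.Icc (0:ℝ) T, N t

/-- `L²` norm in time on `[0,T]` at a fixed spatial point `x`. -/
def eLT2x (T : ℝ) (F : ℝ → ℝ → ℝ) (x : ℝ) : ℝ≥0∞ :=
  (∫⁻ t in Set.Ioc (0:ℝ) T, (‖F t x‖₊ : ℝ≥0∞) ^ 2) ^ (1/2 : ℝ)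

/-- The mixed norm `‖F‖_{L_T^1 L_x^2}`. -/
def eLT1L2 (T : ℝ) (F : ℝ → ℝ → ℝ) : ℝ≥0∞ := ∫⁻ t in Set.Ioc (0:ℝ) T, eL2 (F t)

/-- The mixed norm `‖F‖_{L_x^q L_T^2}`. -/
def eLxqLT2 (q T : ℝ) (F : ℝ → ℝ → ℝ) : ℝ≥0∞ :=
  (∫⁻ x : ℝ, eLT2x T F x ^ q) ^ (1 / q)

/-- The mixed norm `‖F‖_{L_x^∞ L_T^2}`. -/
def eLxInfLT2 (T : ℝ) (F : ℝ → ℝ → ℝ) : ℝ≥0∞ := ⨆ x : ℝ, eLT2x T F x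

/-- The norm `‖u‖_{X_T}` of the resolution space:
`‖u‖_{L_T^∞ H^s} + ‖⟨x⟩^m u‖_{L_T^∞ L_x^∞} + Σ_{γ=1}^{2j+2} ‖⟨x⟩^m ∂_x^γ u‖_{L_T^∞ L_x^2}
 + Σ_{l=0}^{j-1} ‖∂_x^{s+j-l} u‖_{L_x^∞ L_T^2}`. -/
def XT (s j m : ℕ) (T : ℝ) (u : ℝ → ℝ → ℝ) : ℝ≥0∞ :=
  eLTinf T (fun t => eHs s (u t))
  + eLTinf T (fun t => eLinf (fun x => jap x ^ m * u t x))
  + ∑ γ ∈ Finset.Icc 1 (2 * j + 2),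
      eLTinf T (fun t => eL2 (fun x => jap x ^ m * iteratedDeriv γ (u t) x))
  + ∑ l ∈ Finset.range j,
      eLxInfLT2 T (fun t x => iteratedDeriv (s + j - l) (u t) x)

/-- The nonlinearity `|u|^α ∂_x^{2j-1} u`. -/
def nonlin (α : ℝ) (j : ℕ) (u : ℝ → ℝ → ℝ) : ℝ → ℝ → ℝ :=
  fun t x => |u t x| ^ α * iteratedDeriv (2 * j - 1) (u t) x

/-- On every interval some point realises an interpolation bound for the `i`-th derivative by the
mean square of the function. -/
lemma exists_sq_iteratedDeriv_le_mean (i : ℕ) : ∃ C : ℝ, 0 < C ∧ ∀ f : ℝ → ℝ,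
    ContDiff ℝ (⊤ : ℕ∞) f → ∀ x h : ℝ, 0 < h → ∃ ξ ∈ Icc x (x + h),
      (h ^ i * iteratedDeriv i f ξ) ^ 2 ≤ C * (h⁻¹ * ∫ y in x..(x + h), f y ^ 2) := by
  induction i with
  | zero =>
    refine ⟨1, one_pos, fun f hf x h hh => ?_⟩
    have hc : Continuous fun y => f y ^ 2 := hf.continuous.pow 2
    obtain ⟨ξ, hξ, hmin⟩ := (isCompact_Icc (a := x) (b := x + h)).exists_isMinOn
      ⟨x, by constructor <;> linarith⟩ hc.continuousOn
    refine ⟨ξ, hξ, ?_⟩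
    have h1 : ∫ _ in x..(x + h), f ξ ^ 2 ≤ ∫ y in x..(x + h), f y ^ 2 :=
      intervalIntegral.integral_mono_on (by linarith) (by simp) (hc.intervalIntegrable _ _)
        fun y hy => hmin hy
    rw [intervalIntegral.integral_const, smul_eq_mul, add_sub_cancel_left] at h1
    rw [pow_zero, one_mul, one_mul, iteratedDeriv_zero, inv_mul_eq_div, le_div_iff₀ hh]
    linarith
  | succ i ih =>
    obtain ⟨C, hC, H⟩ := ih
    refine ⟨18 * 9 ^ i * (6 * C), by positivity, fun f hf x h hh => ?_⟩
    have hc : Continuous fun y => f y ^ 2 := hf.continuous.pow 2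
    have h3 : 0 < h / 3 := by positivity
    have hmono : ∀ a, x ≤ a → a + h / 3 ≤ x + h →
        ∫ y in a..(a + h / 3), f y ^ 2 ≤ ∫ y in x..(x + h), f y ^ 2 := fun a ha hb =>
      intervalIntegral.integral_mono_interval ha (by linarith) hb
        (Eventually.of_forall fun y => sq_nonneg _) (hc.intervalIntegrable _ _)
    obtain ⟨ξ₁, hξ₁, h₁⟩ := H f hf x (h / 3) h3
    obtain ⟨ξ₂, hξ₂, h₂⟩ := H f hf (x + 2 * h / 3) (h / 3) h3
    have m₁ := hmono x le_rfl (by linarith)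
    have m₂ := hmono (x + 2 * h / 3) (by linarith) (by linarith)
    have hlt : ξ₁ < ξ₂ := by linarith [hξ₁.2, hξ₂.1]
    have hcd : ContDiff ℝ 1 (iteratedDeriv i f) :=
      (hf.of_le (by exact_mod_cast le_top : ((1 + i : ℕ) : WithTop ℕ∞) ≤ _)).iterate_deriv'
        |> fun h => by rwa [← iteratedDeriv_eq_iterate] at h
    obtain ⟨ξ, hξ, hs⟩ := exists_deriv_eq_slope (iteratedDeriv i f) hlt
      hcd.continuous.continuousOn (hcd.differentiable one_ne_zero).differentiableOn
    refine ⟨ξ, ⟨by linarith [hξ.1, hξ₁.1], by linarith [hξ.2, hξ₂.2]⟩, ?_⟩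
    rw [iteratedDeriv_succ, hs]
    set I := ∫ y in x..(x + h), f y ^ 2
    set a := iteratedDeriv i f ξ₁
    set b := iteratedDeriv i f ξ₂
    have hδ : h / 3 ≤ ξ₂ - ξ₁ := by linarith [hξ₁.2, hξ₂.1]
    have e₁ : (h ^ i * a) ^ 2 ≤ 9 ^ i * (3 * C) * (h⁻¹ * I) := by
      have : (h ^ i * a) ^ 2 = 9 ^ i * ((h / 3) ^ i * a) ^ 2 := by
        rw [div_pow, show (9 : ℝ) ^ i = (3 ^ i) ^ 2 by rw [← pow_mul, mul_comm, pow_mul]; norm_num]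
        field_simp
      rw [this, mul_assoc]
      gcongr
      refine h₁.trans ?_
      rw [inv_div, mul_comm (3 : ℝ), mul_assoc, div_eq_mul_inv, mul_assoc]
      gcongr
    have e₂ : (h ^ i * b) ^ 2 ≤ 9 ^ i * (3 * C) * (h⁻¹ * I) := by
      have : (h ^ i * b) ^ 2 = 9 ^ i * ((h / 3) ^ i * b) ^ 2 := by
        rw [div_pow, show (9 : ℝ) ^ i = (3 ^ i) ^ 2 by rw [← pow_mul, mul_comm, pow_mul]; norm_num]
        field_simp
      rw [this, mul_assoc]
      gcongr
      refine h₂.trans ?_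
      rw [inv_div, mul_comm (3 : ℝ), mul_assoc, div_eq_mul_inv, mul_assoc]
      gcongr
    have hq : (h / (ξ₂ - ξ₁)) ^ 2 ≤ 9 := by
      have : h / (ξ₂ - ξ₁) ≤ 3 := by rw [div_le_iff₀ (by linarith)]; linarith
      have : 0 ≤ h / (ξ₂ - ξ₁) := div_nonneg hh.le (by linarith)
      nlinarith
    calc (h ^ (i + 1) * ((b - a) / (ξ₂ - ξ₁))) ^ 2
        = (h / (ξ₂ - ξ₁)) ^ 2 * (h ^ i * b - h ^ i * a) ^ 2 := by
          rw [pow_succ]; ring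
      _ ≤ 9 * (2 * ((h ^ i * b) ^ 2 + (h ^ i * a) ^ 2)) := by
          gcongr
          nlinarith [sq_nonneg (h ^ i * b + h ^ i * a)]
      _ ≤ _ := by nlinarith

lemma sq_intervalIntegral_le {g : ℝ → ℝ} (hg : Continuous g) {a b : ℝ} (hab : a ≤ b) :
    (∫ y in a..b, g y) ^ 2 ≤ (b - a) * ∫ y in a..b, g y ^ 2 := by
  rcases hab.eq_or_lt with rfl | hlt
  · simp
  have hL : 0 < b - a := sub_pos.2 hlt
  set c := (∫ y in a..b, g y) / (b - a) with hc
  have h0 : 0 ≤ ∫ y in a..b, (g y - c) ^ 2 :=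
    intervalIntegral.integral_nonneg hab fun y _ => sq_nonneg _
  have h1 : ∫ y in a..b, (g y - c) ^ 2
      = (∫ y in a..b, g y ^ 2) - 2 * c * (∫ y in a..b, g y) + (b - a) * c ^ 2 := by
    have : ∀ y, (g y - c) ^ 2 = g y ^ 2 - 2 * c * g y + c ^ 2 := fun y => by ring
    simp_rw [this]
    rw [intervalIntegral.integral_add, intervalIntegral.integral_sub,
      intervalIntegral.integral_const_mul, intervalIntegral.integral_const, smul_eq_mul]
    all_goals exact Continuous.intervalIntegrable (by fun_prop) _ _
  have h2 : ∫ y in a..b, g y = c * (b - a) := by rw [hc]; field_simp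
  rw [h1, h2] at h0
  rw [h2]
  nlinarith

/-- Local Landau–Kolmogorov inequality in mean square form: on an interval of length `h` the
intermediate derivatives are controlled by the function and its `n`-th derivative. -/
lemma sq_iteratedDeriv_le_of_mem_Icc (n k : ℕ) (hk : k < n) : ∃ C : ℝ, 0 < C ∧ ∀ f : ℝ → ℝ,
    ContDiff ℝ (⊤ : ℕ∞) f → ∀ x h : ℝ, 0 < h → ∀ y ∈ Icc x (x + h),
      (h ^ (n - 1 - k) * iteratedDeriv (n - 1 - k) f y) ^ 2 ≤
        C * (h⁻¹ * (∫ z in x..(x + h), f z ^ 2)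
          + h ^ (2 * n) * (h⁻¹ * ∫ z in x..(x + h), iteratedDeriv n f z ^ 2)) := by
  induction k with
  | zero =>
    obtain ⟨C, hC, H⟩ := exists_sq_iteratedDeriv_le_mean (n - 1)
    refine ⟨2 * C + 2, by positivity, fun f hf x h hh y hy => ?_⟩
    obtain ⟨ξ, hξ, hb⟩ := H f hf x h hh
    obtain ⟨p, rfl⟩ : ∃ p, n = p + 1 := ⟨n - 1, by omega⟩
    simp only [Nat.add_sub_cancel, Nat.sub_zero] at *
    have hcd : ∀ i : ℕ, ContDiff ℝ 1 (iteratedDeriv i f) := fun i =>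
      (hf.of_le (by exact_mod_cast le_top : ((1 + i : ℕ) : WithTop ℕ∞) ≤ _)).iterate_deriv'
        |> fun h => by rwa [← iteratedDeriv_eq_iterate] at h
    have hcg := (hcd (p + 1)).continuous
    have hcs : Continuous fun z => iteratedDeriv (p + 1) f z ^ 2 := hcg.pow 2
    have hftc : ∀ a b, ∫ z in a..b, iteratedDeriv (p + 1) f z
        = iteratedDeriv p f b - iteratedDeriv p f a := fun a b =>
      intervalIntegral.integral_eq_sub_of_hasDerivAt
        (fun z _ => by
          rw [iteratedDeriv_succ]
          exact ((hcd p).differentiable one_ne_zero z).hasDerivAt)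
        (hcg.intervalIntegrable _ _)
    have hsub : ∀ a b, a ∈ Icc x (x + h) → b ∈ Icc x (x + h) → a ≤ b →
        (iteratedDeriv p f b - iteratedDeriv p f a) ^ 2
          ≤ h * ∫ z in x..(x + h), iteratedDeriv (p + 1) f z ^ 2 := fun a b ha hb hab => by
      rw [← hftc]
      refine (sq_intervalIntegral_le hcg hab).trans ?_
      have h1 := intervalIntegral.integral_mono_interval (μ := volume) ha.1 hab hb.2
        (Eventually.of_forall fun y => sq_nonneg (iteratedDeriv (p + 1) f y))
        (hcs.intervalIntegrable _ _)
      have h2 : 0 ≤ ∫ z in a..b, iteratedDeriv (p + 1) f z ^ 2 :=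
        intervalIntegral.integral_nonneg hab fun y _ => sq_nonneg _
      exact mul_le_mul (by linarith [ha.1, hb.2]) h1 h2 hh.le
    have hd : (iteratedDeriv p f y - iteratedDeriv p f ξ) ^ 2
        ≤ h * ∫ z in x..(x + h), iteratedDeriv (p + 1) f z ^ 2 := by
      rcases le_total ξ y with h1 | h1
      · exact hsub ξ y hξ hy h1
      · rw [← neg_sub, neg_sq]; exact hsub y ξ hy hξ h1
    have hI : 0 ≤ ∫ z in x..(x + h), f z ^ 2 :=
      intervalIntegral.integral_nonneg (by linarith) fun y _ => sq_nonneg _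
    have hJ : 0 ≤ ∫ z in x..(x + h), iteratedDeriv (p + 1) f z ^ 2 :=
      intervalIntegral.integral_nonneg (by linarith) fun y _ => sq_nonneg _
    set I := ∫ z in x..(x + h), f z ^ 2
    set J := ∫ z in x..(x + h), iteratedDeriv (p + 1) f z ^ 2
    have hJe : h ^ (2 * (p + 1)) * (h⁻¹ * J) = (h ^ p) ^ 2 * (h * J) := by
      field_simp
      ring
    have hI' : 0 ≤ h⁻¹ * I := by positivity
    have hJ' : 0 ≤ (h ^ p) ^ 2 * (h * J) := by positivity
    rw [hJe]
    calc (h ^ p * iteratedDeriv p f y) ^ 2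
        ≤ 2 * (h ^ p * iteratedDeriv p f ξ) ^ 2
          + 2 * ((h ^ p) ^ 2 * (iteratedDeriv p f y - iteratedDeriv p f ξ) ^ 2) := by
          nlinarith [sq_nonneg (h ^ p * (iteratedDeriv p f y - 2 * iteratedDeriv p f ξ))]
      _ ≤ 2 * (C * (h⁻¹ * I)) + 2 * ((h ^ p) ^ 2 * (h * J)) := by gcongr
      _ ≤ _ := by nlinarith
  | succ k ih =>
    obtain ⟨C, hC, H⟩ := ih (by omega)
    obtain ⟨C', hC', H'⟩ := exists_sq_iteratedDeriv_le_mean (n - 1 - (k + 1))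
    refine ⟨2 * C' + 2 * C, by positivity, fun f hf x h hh y hy => ?_⟩
    obtain ⟨ξ, hξ, hb⟩ := H' f hf x h hh
    have H := H f hf x h hh
    obtain ⟨p, hp⟩ : ∃ p, n - 1 - (k + 1) = p := ⟨_, rfl⟩
    rw [hp] at hb ⊢
    rw [show n - 1 - k = p + 1 by omega] at H
    have hcd : Differentiable ℝ (iteratedDeriv p f) :=
      hf.differentiable_iteratedDeriv p (by exact_mod_cast WithTop.coe_lt_top p)
    have hI : 0 ≤ ∫ z in x..(x + h), f z ^ 2 :=
      intervalIntegral.integral_nonneg (by linarith) fun y _ => sq_nonneg _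
    have hJ : 0 ≤ ∫ z in x..(x + h), iteratedDeriv n f z ^ 2 :=
      intervalIntegral.integral_nonneg (by linarith) fun y _ => sq_nonneg _
    set I := ∫ z in x..(x + h), f z ^ 2
    set J := ∫ z in x..(x + h), iteratedDeriv n f z ^ 2
    set D := h⁻¹ * I + h ^ (2 * n) * (h⁻¹ * J) with hD
    have hI' : 0 ≤ h⁻¹ * I := by positivity
    have hJ' : 0 ≤ h ^ (2 * n) * (h⁻¹ * J) := by positivity
    have hID : h⁻¹ * I ≤ D := by linarith
    have hder : ∀ z ∈ Icc x (x + h), ‖deriv (iteratedDeriv p f) z‖ ≤ √(C * D) / h ^ (p + 1) := by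
      intro z hz
      rw [← iteratedDeriv_succ, le_div_iff₀ (by positivity), Real.norm_eq_abs]
      have := Real.abs_le_sqrt (H z hz)
      rwa [abs_mul, abs_of_pos (pow_pos hh _), mul_comm] at this
    have hmv := (convex_Icc x (x + h)).norm_image_sub_le_of_norm_deriv_le
      (fun z _ => hcd z) hder hξ hy
    have hd : (h ^ p * (iteratedDeriv p f y - iteratedDeriv p f ξ)) ^ 2 ≤ C * D := by
      have hyξ : ‖y - ξ‖ ≤ h := by
        rw [Real.norm_eq_abs, abs_le]
        constructor <;> linarith [hξ.1, hξ.2, hy.1, hy.2]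
      rw [← Real.sqrt_le_sqrt_iff (by positivity), Real.sqrt_sq_eq_abs, abs_mul,
        abs_of_pos (pow_pos hh _)]
      calc h ^ p * |iteratedDeriv p f y - iteratedDeriv p f ξ|
          ≤ h ^ p * (√(C * D) / h ^ (p + 1) * h) := by
            gcongr
            exact hmv.trans (by gcongr)
        _ = √(C * D) := by rw [pow_succ]; field_simp
    calc (h ^ p * iteratedDeriv p f y) ^ 2
        ≤ 2 * (h ^ p * iteratedDeriv p f ξ) ^ 2
          + 2 * (h ^ p * (iteratedDeriv p f y - iteratedDeriv p f ξ)) ^ 2 := by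
          nlinarith [sq_nonneg (h ^ p * (iteratedDeriv p f y - 2 * iteratedDeriv p f ξ))]
      _ ≤ 2 * (C' * (h⁻¹ * I)) + 2 * (C * D) := by gcongr
      _ ≤ 2 * (C' * D) + 2 * (C * D) := by gcongr
      _ = _ := by ring

lemma sq_iteratedDeriv_le {n i : ℕ} (hi : i < n) : ∃ C : ℝ, 0 < C ∧ ∀ f : ℝ → ℝ,
    ContDiff ℝ (⊤ : ℕ∞) f → ∀ x h : ℝ, 0 < h →
      (h ^ i * iteratedDeriv i f x) ^ 2 ≤ C * (h⁻¹ * (∫ z in x..(x + h), f z ^ 2)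
          + h ^ (2 * n) * (h⁻¹ * ∫ z in x..(x + h), iteratedDeriv n f z ^ 2)) := by
  obtain ⟨C, hC, H⟩ := sq_iteratedDeriv_le_of_mem_Icc n (n - 1 - i) (by omega)
  rw [show n - 1 - (n - 1 - i) = i by omega] at H
  exact ⟨C, hC, fun f hf x h hh => H f hf x h hh x ⟨le_rfl, by linarith⟩⟩

/-- The product `|v|^α v ∏ (v^{(d)} / v)`, where `d` runs over the list `ds`. -/
def jetMonomial (α : ℝ) (ds : List ℕ) (v : ℝ → ℝ) (x : ℝ) : ℝ :=
  |v x| ^ α * v x * (ds.map fun d => iteratedDeriv d v x / v x).prod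

/-- Linear combinations of the products `jetMonomial α ds` over lists of at most `l` positive
orders with sum `n`. -/
def jetSpan (α : ℝ) (n l : ℕ) : Submodule ℝ ((ℝ → ℝ) → ℝ → ℝ) :=
  Submodule.span ℝ (jetMonomial α '' {ds | (∀ d ∈ ds, 1 ≤ d) ∧ ds.sum = n ∧ ds.length ≤ l})

lemma jetMonomial_cons (α : ℝ) (d : ℕ) (ds : List ℕ) :
    jetMonomial α (d :: ds) = (fun v x => iteratedDeriv d v x / v x) * jetMonomial α ds := by
  ext v x
  simp only [jetMonomial, List.map_cons, List.prod_cons, Pi.mul_apply]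
  ring

lemma jetMonomial_mem {α : ℝ} {ds : List ℕ} {n l : ℕ} (h1 : ∀ d ∈ ds, 1 ≤ d) (h2 : ds.sum = n)
    (h3 : ds.length ≤ l) : jetMonomial α ds ∈ jetSpan α n l :=
  Submodule.subset_span ⟨ds, ⟨h1, h2, h3⟩, rfl⟩

lemma jetSpan_mul {α : ℝ} {n l d : ℕ} (hd : 1 ≤ d) {Φ : (ℝ → ℝ) → ℝ → ℝ}
    (hΦ : Φ ∈ jetSpan α n l) :
    (fun v x => iteratedDeriv d v x / v x) * Φ ∈ jetSpan α (d + n) (l + 1) := by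
  induction hΦ using Submodule.span_induction with
  | mem Φ h =>
    obtain ⟨ds, ⟨h1, h2, h3⟩, rfl⟩ := h
    rw [← jetMonomial_cons]
    exact jetMonomial_mem (by simpa [hd] using h1) (by simp [h2]) (by simpa using h3)
  | zero => rw [mul_zero]; exact zero_mem _
  | add Φ Ψ _ _ h1 h2 => rw [mul_add]; exact add_mem h1 h2
  | smul c Φ _ h => rw [mul_smul_comm]; exact Submodule.smul_mem _ c h

lemma hasDerivAt_iteratedDeriv {v : ℝ → ℝ} (hv : ContDiff ℝ (⊤ : ℕ∞) v) (d : ℕ) (x : ℝ) :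
    HasDerivAt (iteratedDeriv d v) (iteratedDeriv (d + 1) v x) x := by
  rw [iteratedDeriv_succ]
  exact (hv.differentiable_iteratedDeriv d
    (by exact_mod_cast WithTop.coe_lt_top d) x).hasDerivAt

lemma hasDerivAt_abs_rpow_mul_self {v : ℝ → ℝ} {v' x : ℝ} (α : ℝ) (hv : HasDerivAt v v' x)
    (hx : v x ≠ 0) :
    HasDerivAt (fun y => |v y| ^ α * v y) ((α + 1) * (v' / v x * (|v x| ^ α * v x))) x := by
  have ha : HasDerivAt (fun y => |v y|) (SignType.sign (v x) * v') x :=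
    (hasDerivAt_abs hx).comp x hv
  have h := (ha.rpow_const (p := α) (Or.inl (abs_ne_zero.2 hx))).mul hv
  refine h.congr_deriv ?_
  rw [Real.rpow_sub_one (abs_ne_zero.2 hx)]
  rcases hx.lt_or_gt with h0 | h0
  · rw [abs_of_neg h0, sign_neg h0]
    field_simp
    simp
  · rw [abs_of_pos h0, sign_pos h0]
    field_simp
    simp

lemma exists_hasDerivAt_jetMonomial (α : ℝ) (ds : List ℕ) (hds : ∀ d ∈ ds, 1 ≤ d) :
    ∃ Ψ ∈ jetSpan α (ds.sum + 1) (ds.length + 1), ∀ v : ℝ → ℝ, ContDiff ℝ (⊤ : ℕ∞) v →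
      (∀ x, v x ≠ 0) → ∀ x, HasDerivAt (jetMonomial α ds v) (Ψ v x) x := by
  induction ds with
  | nil =>
    refine ⟨(α + 1) • jetMonomial α [1],
      Submodule.smul_mem _ _ (jetMonomial_mem (by simp) (by simp) (by simp)),
      fun v hv hv0 x => ?_⟩
    have h := hasDerivAt_abs_rpow_mul_self α (hasDerivAt_iteratedDeriv hv 0 x) (hv0 x)
    simp only [iteratedDeriv_zero] at h
    have hf : jetMonomial α [] v = fun y => |v y| ^ α * v y := by ext y; simp [jetMonomial]
    rw [hf]
    refine h.congr_deriv ?_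
    simp only [jetMonomial, Pi.smul_apply, smul_eq_mul, List.map_cons, List.map_nil,
      List.prod_singleton, zero_add]
    ring
  | cons d ds ih =>
    obtain ⟨Ψ, hΨ, H⟩ := ih fun e he => hds e (by simp [he])
    have hd : 1 ≤ d := hds d (by simp)
    have hds' : ∀ e ∈ ds, 1 ≤ e := fun e he => hds e (by simp [he])
    refine ⟨jetMonomial α ((d + 1) :: ds) - jetMonomial α (1 :: d :: ds)
      + (fun v x => iteratedDeriv d v x / v x) * Ψ, ?_, fun v hv hv0 x => ?_⟩
    · refine add_mem (sub_mem ?_ ?_) ?_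
      · exact jetMonomial_mem (by simpa using hds') (by simp; ring) (by simp)
      · exact jetMonomial_mem (by simpa [hd] using hds') (by simp; ring) (by simp)
      · have := jetSpan_mul hd hΨ
        rwa [← add_assoc] at this
    · have h0 := hasDerivAt_iteratedDeriv hv 0 x
      rw [iteratedDeriv_zero] at h0
      have h := ((hasDerivAt_iteratedDeriv hv d x).div h0 (hv0 x)).mul (H v hv hv0 x)
      rw [jetMonomial_cons]
      refine h.congr_deriv ?_
      have := hv0 x
      simp only [jetMonomial_cons, Pi.add_apply, Pi.sub_apply, Pi.mul_apply, Pi.div_apply]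
      field_simp

lemma exists_hasDerivAt_of_mem_jetSpan {α : ℝ} {n l : ℕ} {Φ : (ℝ → ℝ) → ℝ → ℝ}
    (hΦ : Φ ∈ jetSpan α n l) :
    ∃ Ψ ∈ jetSpan α (n + 1) (l + 1), ∀ v : ℝ → ℝ, ContDiff ℝ (⊤ : ℕ∞) v →
      (∀ x, v x ≠ 0) → ∀ x, HasDerivAt (Φ v) (Ψ v x) x := by
  induction hΦ using Submodule.span_induction with
  | mem Φ h =>
    obtain ⟨ds, ⟨h1, h2, h3⟩, rfl⟩ := h
    obtain ⟨Ψ, hΨ, H⟩ := exists_hasDerivAt_jetMonomial α ds h1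
    refine ⟨Ψ, Submodule.span_mono (image_mono ?_) hΨ, H⟩
    rintro es ⟨e1, e2, e3⟩
    exact ⟨e1, by omega, by omega⟩
  | zero => exact ⟨0, zero_mem _, fun v _ _ x => hasDerivAt_const x 0⟩
  | add Φ Φ' _ _ h h' =>
    obtain ⟨Ψ, hΨ, H⟩ := h
    obtain ⟨Ψ', hΨ', H'⟩ := h'
    exact ⟨Ψ + Ψ', add_mem hΨ hΨ', fun v hv hv0 x => (H v hv hv0 x).add (H' v hv hv0 x)⟩
  | smul c Φ _ h =>
    obtain ⟨Ψ, hΨ, H⟩ := h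
    exact ⟨c • Ψ, Submodule.smul_mem _ c hΨ, fun v hv hv0 x => (H v hv hv0 x).const_smul c⟩

lemma exists_iteratedDeriv_nonlin_eq (α : ℝ) {p : ℕ} (hp : 1 ≤ p) (n : ℕ) :
    ∃ Φ ∈ jetSpan α (p + n) (n + 1), ∀ v : ℝ → ℝ, ContDiff ℝ (⊤ : ℕ∞) v → (∀ x, v x ≠ 0) →
      iteratedDeriv n (fun x => |v x| ^ α * iteratedDeriv p v x) = Φ v := by
  induction n with
  | zero =>
    refine ⟨jetMonomial α [p], jetMonomial_mem (by simpa) (by simp) (by simp),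
      fun v hv hv0 => ?_⟩
    ext x
    have := hv0 x
    simp only [iteratedDeriv_zero, jetMonomial, List.map_cons, List.map_nil, List.prod_singleton]
    field_simp
  | succ n ih =>
    obtain ⟨Φ, hΦ, H⟩ := ih
    obtain ⟨Ψ, hΨ, H'⟩ := exists_hasDerivAt_of_mem_jetSpan hΦ
    refine ⟨Ψ, hΨ, fun v hv hv0 => ?_⟩
    ext x
    rw [iteratedDeriv_succ, H v hv hv0]
    exact (H' v hv hv0 x).deriv

lemma eLT2x_eq_eLpNorm (T : ℝ) (F : ℝ → ℝ → ℝ) (x : ℝ) :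
    eLT2x T F x = eLpNorm (fun t => F t x) 2 (volume.restrict (Ioc 0 T)) := by
  rw [eLpNorm_eq_lintegral_rpow_enorm_toReal two_ne_zero ENNReal.ofNat_ne_top]
  simp [eLT2x, enorm_eq_nnnorm]

lemma eLT2x_le_mul {T c : ℝ} {F G : ℝ → ℝ → ℝ} {x : ℝ}
    (h : ∀ t ∈ Ioc 0 T, |F t x| ≤ c * |G t x|) :
    eLT2x T F x ≤ ENNReal.ofReal c * eLT2x T G x := by
  rw [eLT2x_eq_eLpNorm, eLT2x_eq_eLpNorm]
  exact eLpNorm_le_mul_eLpNorm_of_ae_le_mul (ae_restrict_of_forall_mem measurableSet_Ioc h) _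

lemma eLT2x_le_of_bound {T c : ℝ} {F : ℝ → ℝ → ℝ} {x : ℝ}
    (h : ∀ t ∈ Ioc 0 T, |F t x| ≤ c) :
    eLT2x T F x ≤ ENNReal.ofReal (c * √T) := by
  refine (eLT2x_le_mul (G := fun _ _ => 1) (c := c) (by simpa using h)).trans ?_
  rcases le_or_gt c 0 with hc | hc
  · simp [ENNReal.ofReal_of_nonpos hc]
  rw [ENNReal.ofReal_mul hc.le]
  gcongr
  simp only [eLT2x, nnnorm_one, ENNReal.coe_one, one_pow, lintegral_const,
    Measure.restrict_apply_univ, Real.volume_Ioc, sub_zero, one_mul, Real.sqrt_eq_rpow]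
  rcases le_or_gt T 0 with hT | hT
  · simp [ENNReal.ofReal_of_nonpos hT]
  · rw [ENNReal.ofReal_rpow_of_pos hT]

lemma eLT2x_add_le {T : ℝ} {F G : ℝ → ℝ → ℝ} {x : ℝ} (hF : Measurable fun t => F t x)
    (hG : Measurable fun t => G t x) :
    eLT2x T (fun t x => F t x + G t x) x ≤ eLT2x T F x + eLT2x T G x := by
  simp only [eLT2x_eq_eLpNorm]
  exact eLpNorm_add_le hF.aestronglyMeasurable hG.aestronglyMeasurable (by norm_num)

lemma one_le_jap (x : ℝ) : 1 ≤ jap x := by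
  rw [jap, Real.one_le_sqrt]
  nlinarith [sq_nonneg x]

lemma jap_pos (x : ℝ) : 0 < jap x := one_pos.trans_le (one_le_jap x)

lemma abs_jetMonomial {α : ℝ} (ds : List ℕ) {v : ℝ → ℝ} {x : ℝ} (hx : v x ≠ 0) :
    |jetMonomial α ds v x|
      = |v x| ^ (α + 1 - ds.length) * (ds.map fun d => |iteratedDeriv d v x|).prod := by
  induction ds with
  | nil =>
    rw [jetMonomial, List.length_nil, Nat.cast_zero, sub_zero,
      Real.rpow_add_one (abs_ne_zero.2 hx)]
    simp [abs_mul, abs_of_nonneg (Real.rpow_nonneg (abs_nonneg (v x)) α)]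
  | cons d ds ih =>
    rw [jetMonomial_cons, Pi.mul_apply, Pi.mul_apply, abs_mul, ih, abs_div, List.length_cons,
      Nat.cast_succ, ← sub_sub, Real.rpow_sub_one (abs_ne_zero.2 hx), List.map_cons,
      List.prod_cons]
    ring

lemma list_sum_tsub (a : ℕ) (ds : List ℕ) :
    (ds.map fun d => d - a).sum = 0 ∨
      (∃ d ∈ ds, a < d ∧ d ≤ ds.sum ∧ (ds.map fun d => d - a).sum = d - a) ∨
      (ds.map fun d => d - a).sum + 2 * a ≤ ds.sum := by
  induction ds with
  | nil => simp
  | cons d ds ih =>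
    simp only [List.map_cons, List.sum_cons, List.mem_cons, exists_eq_or_imp]
    rcases le_or_gt d a with hd | hd
    · rcases ih with h | ⟨e, he, h1, h2, h3⟩ | h
      · exact Or.inl (by omega)
      · exact Or.inr (Or.inl (Or.inr ⟨e, he, h1, by omega, by omega⟩))
      · exact Or.inr (Or.inr (by omega))
    · rcases ih with h | ⟨e, he, h1, h2, h3⟩ | h
      · exact Or.inr (Or.inl (Or.inl ⟨hd, by omega, by omega⟩))
      · exact Or.inr (Or.inr (by omega))
      · exact Or.inr (Or.inr (by omega))

/-- The pointwise and local smoothing bounds on the derivatives of `u` that are consequences of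
`‖u‖_{X_T} = X` and `⟨x⟩^m |u| ≥ lam / 2`. -/
structure JetBounds (s j m : ℕ) (K T lam X : ℝ) (u : ℝ → ℝ → ℝ) : Prop where
  lam_pos : 0 < lam
  lam_le : lam ≤ 2 * X
  measurable : ∀ d x, Measurable fun t => iteratedDeriv d (u t) x
  lower : ∀ t ∈ Ioc 0 T, ∀ x, lam / 2 ≤ jap x ^ m * |u t x|
  upper : ∀ t ∈ Ioc 0 T, ∀ x, jap x ^ m * |u t x| ≤ X
  low : ∀ t ∈ Ioc 0 T, ∀ x d, 1 ≤ d → d ≤ s - 1 → |iteratedDeriv d (u t) x| ≤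
    K * X * jap x ^ (-(m : ℝ) + m / (s - 2 * j - 2 : ℝ) * ((d - (2 * j + 1) : ℕ) : ℝ))
  high : ∀ x i, 1 ≤ i → i ≤ j → eLT2x T (fun t x => iteratedDeriv (s - 1 + i) (u t) x) x ≤
    ENNReal.ofReal (K * ((X / lam) ^ i * (√T * X) + (lam / X) ^ (j + 1 - i) * X))
  top : ∀ x, eLT2x T (fun t x => iteratedDeriv (s + j) (u t) x) x ≤ ENNReal.ofReal X

namespace JetBounds

variable {s j m : ℕ} {K T lam X : ℝ} {u : ℝ → ℝ → ℝ}

lemma X_pos (h : JetBounds s j m K T lam X u) : 0 < X := by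
  linarith [h.lam_pos, h.lam_le]

lemma ne_zero (h : JetBounds s j m K T lam X u) {t : ℝ} (ht : t ∈ Ioc 0 T) (x : ℝ) :
    u t x ≠ 0 := fun h0 => by
  have := h.lower t ht x
  rw [h0, abs_zero, mul_zero] at this
  linarith [h.lam_pos]

lemma measurable_jetMonomial (h : JetBounds s j m K T lam X u) (α : ℝ) (ds : List ℕ) (x : ℝ) :
    Measurable fun t => jetMonomial α ds (u t) x := by
  have h0 : Measurable fun t => u t x := by simpa using h.measurable 0 x
  induction ds with
  | nil =>
    simp only [jetMonomial, List.map_nil, List.prod_nil, mul_one]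
    have : Measurable fun t => |u t x| := by simpa using h0.norm
    exact (this.pow_const α).mul h0
  | cons d ds ih =>
    rw [jetMonomial_cons]
    exact ((h.measurable d x).div h0).mul ih

lemma measurable_of_mem_jetSpan (h : JetBounds s j m K T lam X u) {α : ℝ} {n l : ℕ}
    {Φ : (ℝ → ℝ) → ℝ → ℝ} (hΦ : Φ ∈ jetSpan α n l) (x : ℝ) :
    Measurable fun t => Φ (u t) x := by
  induction hΦ using Submodule.span_induction with
  | mem Φ h' =>
    obtain ⟨ds, -, rfl⟩ := h'
    exact h.measurable_jetMonomial α ds x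
  | zero => exact measurable_const
  | add Φ Φ' _ _ h1 h2 => exact h1.add h2
  | smul c Φ _ h1 => exact h1.const_mul c

lemma prod_le (h : JetBounds s j m K T lam X u) (hK : 0 ≤ K) {t : ℝ} (ht : t ∈ Ioc 0 T) (x : ℝ)
    (ds : List ℕ) (hds : ∀ d ∈ ds, 1 ≤ d ∧ d ≤ s - 1) :
    (ds.map fun d => |iteratedDeriv d (u t) x|).prod ≤ (K * X) ^ ds.length *
      jap x ^ (-(m * ds.length : ℝ)
        + m / (s - 2 * j - 2 : ℝ) * (((ds.map fun d => d - (2 * j + 1)).sum : ℕ) : ℝ)) := by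
  induction ds with
  | nil => simp
  | cons d ds ih =>
    have hX := h.X_pos
    have h1 := h.low t ht x d (hds d (by simp)).1 (hds d (by simp)).2
    have h2 := ih fun e he => hds e (by simp [he])
    have hj := jap_pos x
    simp only [List.map_cons, List.prod_cons, List.length_cons, List.sum_cons]
    refine (mul_le_mul h1 h2 (List.prod_nonneg (by simp)) (by positivity)).trans_eq ?_
    rw [pow_succ, mul_mul_mul_comm, ← Real.rpow_add hj, mul_comm ((K * X) ^ _)]
    congr 2
    push_cast
    ring

/-- A product of derivatives of order less than `s`, with one factor fewer in the weight. -/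
lemma prod_le_of_sum_le (h : JetBounds s j m K T lam X u) (hK : 0 ≤ K) (hs : 5 * j + 1 ≤ s)
    (hj1 : 1 ≤ j) {t : ℝ} (ht : t ∈ Ioc 0 T) (x : ℝ) (ds : List ℕ)
    (hds : ∀ d ∈ ds, 1 ≤ d ∧ d ≤ s - 1) (hsum : ds.sum ≤ s + j) :
    (ds.map fun d => |iteratedDeriv d (u t) x|).prod ≤
      (K * X) ^ ds.length * jap x ^ (-(m * (ds.length - 1) : ℝ)) := by
  have hX := h.X_pos
  refine (h.prod_le hK ht x ds hds).trans ?_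
  have hS : (ds.map fun d => d - (2 * j + 1)).sum ≤ s - 2 * j - 2 := by
    rcases list_sum_tsub (2 * j + 1) ds with h0 | ⟨d, hd, h1, h2, h3⟩ | h0
    · omega
    · have := (hds d hd).2
      omega
    · omega
  have hS' : (((ds.map fun d => d - (2 * j + 1)).sum : ℕ) : ℝ) ≤ s - 2 * j - 2 := by
    have h2 : (ds.map fun d => d - (2 * j + 1)).sum + 2 * j + 2 ≤ s := by omega
    have : (((ds.map fun d => d - (2 * j + 1)).sum : ℕ) : ℝ) + 2 * j + 2 ≤ s := by
      exact_mod_cast h2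
    linarith
  have hpos : (0 : ℝ) < s - 2 * j - 2 := by
    have : (2 * j + 2 : ℕ) < s := by omega
    have : ((2 * j + 2 : ℕ) : ℝ) < s := by exact_mod_cast this
    push_cast at this
    linarith
  have hle : (m : ℝ) / (s - 2 * j - 2 : ℝ)
      * (((ds.map fun d => d - (2 * j + 1)).sum : ℕ) : ℝ) ≤ m := by
    rw [div_mul_eq_mul_div, div_le_iff₀ hpos]
    gcongr
  gcongr
  · exact one_le_jap x
  · linarith

/-- A product of derivatives of order at most `2 * j + 1`. -/
lemma prod_le_of_le (h : JetBounds s j m K T lam X u) (hK : 0 ≤ K) (hs : 5 * j + 1 ≤ s)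
    (hj1 : 1 ≤ j) {t : ℝ} (ht : t ∈ Ioc 0 T) (x : ℝ) (ds : List ℕ)
    (hds : ∀ d ∈ ds, 1 ≤ d ∧ d ≤ 2 * j + 1) :
    (ds.map fun d => |iteratedDeriv d (u t) x|).prod ≤
      (K * X) ^ ds.length * jap x ^ (-(m * ds.length : ℝ)) := by
  have := h.prod_le hK ht x ds fun d hd => ⟨(hds d hd).1, by have := (hds d hd).2; omega⟩
  have h0 : (ds.map fun d => d - (2 * j + 1)).sum = 0 := by
    rw [List.sum_eq_zero_iff]
    simpa [Nat.sub_eq_zero_iff_le] using fun d hd => (hds d hd).2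
  simpa [h0] using this

lemma abs_rpow_le (h : JetBounds s j m K T lam X u) {t : ℝ} (ht : t ∈ Ioc 0 T) (x : ℝ)
    {β : ℝ} (hβ : β ≤ 0) :
    |u t x| ^ β ≤ (lam / 2) ^ β * jap x ^ (-(m * β)) := by
  have hl := h.lam_pos
  have hj := jap_pos x
  have h1 : lam / 2 * jap x ^ (-(m : ℝ)) ≤ |u t x| := by
    rw [Real.rpow_neg hj.le, Real.rpow_natCast, ← div_eq_mul_inv, div_le_iff₀ (by positivity),
      mul_comm]
    exact h.lower t ht x
  have h2 := Real.rpow_le_rpow_of_nonpos (by positivity) h1 hβ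
  rwa [Real.mul_rpow (by positivity) (by positivity), ← Real.rpow_mul hj.le, neg_mul] at h2

lemma abs_rpow_le' (h : JetBounds s j m K T lam X u) {t : ℝ} (ht : t ∈ Ioc 0 T) (x : ℝ)
    {β : ℝ} (hβ : 0 ≤ β) :
    |u t x| ^ β ≤ X ^ β * jap x ^ (-(m * β)) := by
  have hj := jap_pos x
  have hX := h.X_pos
  have h1 : |u t x| ≤ X * jap x ^ (-(m : ℝ)) := by
    rw [Real.rpow_neg hj.le, Real.rpow_natCast, ← div_eq_mul_inv, le_div_iff₀ (by positivity),
      mul_comm]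
    exact h.upper t ht x
  have h2 := Real.rpow_le_rpow (abs_nonneg _) h1 hβ
  rwa [Real.mul_rpow hX.le (by positivity), ← Real.rpow_mul hj.le, neg_mul] at h2

end JetBounds

/-- Powers of `X / lam` are dominated by higher ones. -/
lemma rpow_sub_mul_pow_le {lam X α : ℝ} (hl : 0 < lam) (hX : lam ≤ 2 * X) {r N : ℕ} (hr : r ≤ N) :
    lam ^ (α - r) * X ^ (r + 1) ≤ 2 ^ N * (lam ^ (α - N) * X ^ (N + 1)) := by
  have hX0 : 0 < X := by linarith
  obtain ⟨k, rfl⟩ := Nat.exists_eq_add_of_le hr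
  have h1 : lam ^ (α - r) = lam ^ (α - (r + k : ℕ)) * lam ^ k := by
    rw [← Real.rpow_natCast lam k, ← Real.rpow_add hl]
    congr 1
    push_cast
    ring
  have h2 : lam ^ k ≤ 2 ^ (r + k) * X ^ k := calc
    lam ^ k ≤ (2 * X) ^ k := by gcongr
    _ = 2 ^ k * X ^ k := mul_pow _ _ _
    _ ≤ _ := by
      gcongr
      · norm_num
      · omega
  calc lam ^ (α - r) * X ^ (r + 1)
      = lam ^ (α - (r + k : ℕ)) * lam ^ k * X ^ (r + 1) := by rw [h1]
    _ ≤ lam ^ (α - (r + k : ℕ)) * (2 ^ (r + k) * X ^ k) * X ^ (r + 1) := by gcongr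
    _ = _ := by ring

lemma rpow_sub_mul_div_pow_le {lam X α : ℝ} (hα : 0 ≤ α) (hl : 0 < lam) (hX : lam ≤ 2 * X)
    {r k : ℕ} (hr : r ≤ k) :
    lam ^ (α - r) * X ^ r * ((lam / X) ^ k * X) ≤ 2 ^ (α + k) * X ^ (α + 1) := by
  have hX0 : 0 < X := by linarith
  obtain ⟨p, rfl⟩ := Nat.exists_eq_add_of_le hr
  have h1 : lam ^ (α - r) * lam ^ (r + p) = lam ^ (α + p) := by
    rw [← Real.rpow_natCast lam, ← Real.rpow_add hl]
    congr 1
    push_cast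
    ring
  have h2 : lam ^ (α + p) ≤ 2 ^ (α + (r + p : ℕ)) * (X ^ α * X ^ p) := calc
    lam ^ (α + p) ≤ (2 * X) ^ (α + p) := by gcongr
    _ = 2 ^ (α + p) * (X ^ α * X ^ p) := by
      rw [Real.mul_rpow two_pos.le hX0.le, Real.rpow_add hX0, Real.rpow_natCast]
    _ ≤ _ := by
      gcongr
      · norm_num
      · omega
  calc lam ^ (α - r) * X ^ r * ((lam / X) ^ (r + p) * X)
      = (lam ^ (α - r) * lam ^ (r + p)) * (X * (X ^ p)⁻¹) := by
        rw [div_pow, pow_add X]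
        field_simp
    _ ≤ 2 ^ (α + (r + p : ℕ)) * (X ^ α * X ^ p) * (X * (X ^ p)⁻¹) := by rw [h1]; gcongr
    _ = _ := by
      rw [Real.rpow_add_one hX0.ne']
      field_simp

lemma eLT2x_jetMonomial_low_le {s j m r : ℕ} {K T lam X α : ℝ} {u : ℝ → ℝ → ℝ}
    (h : JetBounds s j m K T lam X u) (hK : 0 ≤ K) (hα : α < 1) (hs : 5 * j + 1 ≤ s)
    (hj : 1 ≤ j) {ds : List ℕ} (hds : ∀ d ∈ ds, 1 ≤ d ∧ d ≤ s - 1) (hsum : ds.sum = s + j)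
    (hr : ds.length = r + 1) (hr1 : 1 ≤ r) (x : ℝ) :
    eLT2x T (fun t x => jetMonomial α ds (u t) x) x ≤
      ENNReal.ofReal (jap x ^ (-(m * α)) * ((2 ^ (α - r))⁻¹ * K ^ (r + 1))
        * (√T * (lam ^ (α - r) * X ^ (r + 1)))) := by
  have hl := h.lam_pos
  have hX := h.X_pos
  have hx := jap_pos x
  have hr1' : (1 : ℝ) ≤ r := by exact_mod_cast hr1
  refine (eLT2x_le_of_bound (c := (lam / 2) ^ (α - r) * jap x ^ (-(m * (α - r)))
    * ((K * X) ^ (r + 1) * jap x ^ (-(m * r : ℝ)))) fun t ht => ?_).trans_eq ?_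
  · rw [abs_jetMonomial ds (h.ne_zero ht x), hr]
    have h1 := h.abs_rpow_le ht x (β := α - r) (by linarith)
    have h2 := h.prod_le_of_sum_le hK hs hj ht x ds hds hsum.le
    rw [hr, Nat.cast_succ, add_sub_cancel_right] at h2
    rw [Nat.cast_succ, add_sub_add_right_eq_sub]
    exact mul_le_mul h1 h2 (List.prod_nonneg (by simp)) (by positivity)
  · congr 1
    have e1 : jap x ^ (-(m * α)) = jap x ^ (-(m * (α - r))) * jap x ^ (-(m * r : ℝ)) := by
      rw [← Real.rpow_add hx]
      congr 1
      ring
    rw [e1, Real.div_rpow hl.le two_pos.le, mul_pow]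
    ring

lemma eLT2x_jetMonomial_high_le {s j m r : ℕ} {K T lam X α : ℝ} {u : ℝ → ℝ → ℝ}
    (h : JetBounds s j m K T lam X u) (hK : 0 ≤ K) (hα : α < 1) (hs : 5 * j + 1 ≤ s)
    (hj : 1 ≤ j) {d : ℕ} {es : List ℕ} (hes : ∀ d ∈ es, 1 ≤ d ∧ d ≤ 2 * j + 1)
    (hr : es.length = r) (hr1 : 1 ≤ r) (x : ℝ) :
    eLT2x T (fun t x => jetMonomial α (d :: es) (u t) x) x ≤
      ENNReal.ofReal (jap x ^ (-(m * α)) * ((2 ^ (α - r))⁻¹ * K ^ r)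
        * (lam ^ (α - r) * X ^ r)) * eLT2x T (fun t x => iteratedDeriv d (u t) x) x := by
  have hl := h.lam_pos
  have hX := h.X_pos
  have hx := jap_pos x
  have hr1' : (1 : ℝ) ≤ r := by exact_mod_cast hr1
  refine eLT2x_le_mul fun t ht => ?_
  rw [abs_jetMonomial _ (h.ne_zero ht x), List.length_cons, List.map_cons, List.prod_cons, hr,
    Nat.cast_succ, add_sub_add_right_eq_sub]
  have h1 := h.abs_rpow_le ht x (β := α - r) (by linarith)
  have h2 := h.prod_le_of_le hK hs hj ht x es hes
  rw [hr] at h2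
  have e1 : jap x ^ (-(m * α)) = jap x ^ (-(m * (α - r))) * jap x ^ (-(m * r : ℝ)) := by
    rw [← Real.rpow_add hx]
    congr 1
    ring
  rw [mul_comm |iteratedDeriv d (u t) x|, ← mul_assoc]
  refine mul_le_mul_of_nonneg_right ?_ (abs_nonneg _)
  refine (mul_le_mul h1 h2 (List.prod_nonneg (by simp)) (by positivity)).trans_eq ?_
  rw [e1, Real.div_rpow hl.le two_pos.le, mul_pow]
  ring

lemma exists_eLT2x_jetMonomial_le {s j : ℕ} (m : ℕ) {K α : ℝ} (hK : 0 ≤ K) (hα0 : 0 ≤ α)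
    (hα : α < 1) (hs : 5 * j + 1 ≤ s) (hj : 1 ≤ j) {ds : List ℕ} (hds : ∀ d ∈ ds, 1 ≤ d)
    (hsum : ds.sum = s + j) (hlen : ds.length ≤ s - j + 2) :
    ∃ C : ℝ, 0 ≤ C ∧ ∀ (T lam X : ℝ) (u : ℝ → ℝ → ℝ), JetBounds s j m K T lam X u → ∀ x,
      eLT2x T (fun t x => jetMonomial α ds (u t) x) x ≤
        ENNReal.ofReal (jap x ^ (-(m * α)) * C * (X ^ (α + 1)
          + √T * (lam ^ (α - (s - j + 1 : ℕ)) * X ^ (s - j + 1 + 1)))) := by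
  obtain ⟨N, hN⟩ : ∃ N, s - j + 1 = N := ⟨_, rfl⟩
  rw [hN]
  by_cases hlow : ∀ d ∈ ds, d ≤ s - 1
  · obtain ⟨r, hr⟩ : ∃ r, ds.length = r + 1 := by
      refine ⟨ds.length - 1, ?_⟩
      rcases ds with _ | ⟨d, ds⟩
      · simp at hsum; omega
      · simp
    have hr1 : 1 ≤ r := by
      by_contra hr1
      obtain ⟨d, rfl⟩ := List.length_eq_one_iff.1 (show ds.length = 1 by omega)
      have := hlow d (by simp)
      simp at hsum
      omega
    refine ⟨(2 ^ (α - r))⁻¹ * K ^ (r + 1) * 2 ^ N, by positivity, fun T lam X u h x =>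
      (eLT2x_jetMonomial_low_le h hK hα hs hj (fun d hd => ⟨hds d hd, hlow d hd⟩) hsum hr hr1
        x).trans (ENNReal.ofReal_le_ofReal ?_)⟩
    have hl := h.lam_pos
    have hX := h.X_pos
    have hx := jap_pos x
    have h1 := rpow_sub_mul_pow_le (α := α) hl h.lam_le (show r ≤ N by omega)
    calc _ ≤ jap x ^ (-(m * α)) * ((2 ^ (α - r))⁻¹ * K ^ (r + 1))
          * (√T * (2 ^ N * (lam ^ (α - N) * X ^ (N + 1)))) := by gcongr
      _ = jap x ^ (-(m * α)) * ((2 ^ (α - r))⁻¹ * K ^ (r + 1) * 2 ^ N)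
          * (√T * (lam ^ (α - N) * X ^ (N + 1))) := by ring
      _ ≤ _ := by
        gcongr
        have : 0 ≤ X ^ (α + 1) := by positivity
        linarith
  push Not at hlow
  obtain ⟨d, hd, hds1⟩ := hlow
  have hperm := List.perm_cons_erase hd
  obtain ⟨es, hes⟩ : ∃ es, ds.erase d = es := ⟨_, rfl⟩
  rw [hes] at hperm
  have heq : jetMonomial α ds = jetMonomial α (d :: es) := by
    ext v x
    simp only [jetMonomial, (hperm.map _).prod_eq]
  have hsum' : d + es.sum = s + j := by rw [← hsum, hperm.sum_eq, List.sum_cons]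
  have hes1 : ∀ e ∈ es, 1 ≤ e := fun e he => hds e (hperm.mem_iff.2 (by simp [he]))
  have hes2 : ∀ e ∈ es, e ≤ 2 * j + 1 := fun e he => by
    have := List.single_le_sum (fun _ _ => Nat.zero_le _) e he
    omega
  have hlen' : es.length ≤ es.sum := List.length_le_sum_of_one_le es hes1
  rw [heq]
  obtain ⟨r, hr⟩ : ∃ r, es.length = r := ⟨_, rfl⟩
  rcases Nat.eq_zero_or_pos r with hr0 | hr1
  · refine ⟨1, zero_le_one, fun T lam X u h x => ?_⟩
    obtain rfl : es = [] := List.length_eq_zero_iff.1 (hr.trans hr0)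
    have hl := h.lam_pos
    have hX := h.X_pos
    have hx := jap_pos x
    obtain rfl : d = s + j := by simpa using hsum'
    refine (eLT2x_le_mul (c := X ^ α * jap x ^ (-(m * α)))
      (G := fun t x => iteratedDeriv (s + j) (u t) x) fun t ht => ?_).trans ?_
    · rw [abs_jetMonomial _ (h.ne_zero ht x)]
      simp only [List.length_singleton, Nat.cast_one, add_sub_cancel_right, List.map_cons,
        List.map_nil, List.prod_singleton]
      gcongr
      exact h.abs_rpow_le' ht x hα0
    · refine (mul_le_mul_right (h.top x) _).trans ?_
      rw [← ENNReal.ofReal_mul (by positivity)]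
      refine ENNReal.ofReal_le_ofReal ?_
      rw [Real.rpow_add_one hX.ne']
      calc X ^ α * jap x ^ (-(m * α)) * X = jap x ^ (-(m * α)) * 1 * (X ^ α * X) := by ring
        _ ≤ _ := by
          gcongr
          have : 0 ≤ √T * (lam ^ (α - N) * X ^ (N + 1)) := by positivity
          linarith
  · obtain ⟨i, hi⟩ : ∃ i, d = s - 1 + i := ⟨d - (s - 1), by omega⟩
    obtain ⟨k, hk⟩ : ∃ k, es.sum = k := ⟨_, rfl⟩
    refine ⟨(2 ^ (α - r))⁻¹ * K ^ r * (K * (2 ^ N + 2 ^ (α + k))), by positivity,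
      fun T lam X u h x => (eLT2x_jetMonomial_high_le h hK hα hs hj
        (fun e he => ⟨hes1 e he, hes2 e he⟩) hr hr1 x).trans ?_⟩
    have hl := h.lam_pos
    have hX := h.X_pos
    have hx := jap_pos x
    rw [hi]
    refine (mul_le_mul_right (h.high x i (by omega) (by omega)) _).trans ?_
    rw [← ENNReal.ofReal_mul (by positivity)]
    refine ENNReal.ofReal_le_ofReal ?_
    rw [show j + 1 - i = k by omega]
    have h1 := rpow_sub_mul_div_pow_le (α := α) hα0 hl h.lam_le (show r ≤ k by omega)
    have h2 := rpow_sub_mul_pow_le (α := α) hl h.lam_le (show r + i ≤ N by omega)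
    have h3 : lam ^ (α - r) * X ^ r * ((X / lam) ^ i * (√T * X))
        = √T * (lam ^ (α - (r + i : ℕ)) * X ^ (r + i + 1)) := by
      have : lam ^ (α - r) = lam ^ (α - (r + i : ℕ)) * lam ^ i := by
        rw [← Real.rpow_natCast lam, ← Real.rpow_add hl]
        congr 1
        push_cast
        ring
      rw [this, div_pow]
      field_simp
      ring
    calc jap x ^ (-(m * α)) * ((2 ^ (α - r))⁻¹ * K ^ r) * (lam ^ (α - r) * X ^ r)
          * (K * ((X / lam) ^ i * (√T * X) + (lam / X) ^ k * X))
        = jap x ^ (-(m * α)) * ((2 ^ (α - r))⁻¹ * K ^ r * K)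
          * (lam ^ (α - r) * X ^ r * ((X / lam) ^ i * (√T * X))
            + lam ^ (α - r) * X ^ r * ((lam / X) ^ k * X)) := by ring
      _ ≤ jap x ^ (-(m * α)) * ((2 ^ (α - r))⁻¹ * K ^ r * K)
          * (√T * (2 ^ N * (lam ^ (α - N) * X ^ (N + 1))) + 2 ^ (α + k) * X ^ (α + 1)) := by
          rw [h3]
          gcongr
      _ ≤ jap x ^ (-(m * α)) * ((2 ^ (α - r))⁻¹ * K ^ r * K)
          * ((2 ^ N + 2 ^ (α + k)) * (X ^ (α + 1) + √T * (lam ^ (α - N) * X ^ (N + 1)))) := by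
          gcongr
          have p1 : 0 ≤ 2 ^ N * X ^ (α + 1) := by positivity
          have p2 : 0 ≤ 2 ^ (α + k) * (√T * (lam ^ (α - N) * X ^ (N + 1))) := by positivity
          linarith
      _ = _ := by ring

lemma exists_eLT2x_jetSpan_le {s j : ℕ} (m : ℕ) {K α : ℝ} (hK : 0 ≤ K) (hα0 : 0 ≤ α)
    (hα : α < 1) (hs : 5 * j + 1 ≤ s) (hj : 1 ≤ j) {Φ : (ℝ → ℝ) → ℝ → ℝ}
    (hΦ : Φ ∈ jetSpan α (s + j) (s - j + 2)) :
    ∃ C : ℝ, 0 ≤ C ∧ ∀ (T lam X : ℝ) (u : ℝ → ℝ → ℝ), JetBounds s j m K T lam X u → ∀ x,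
      eLT2x T (fun t x => Φ (u t) x) x ≤
        ENNReal.ofReal (jap x ^ (-(m * α)) * C * (X ^ (α + 1)
          + √T * (lam ^ (α - (s - j + 1 : ℕ)) * X ^ (s - j + 1 + 1)))) := by
  induction hΦ using Submodule.span_induction with
  | mem Φ h =>
    obtain ⟨ds, ⟨h1, h2, h3⟩, rfl⟩ := h
    exact exists_eLT2x_jetMonomial_le m hK hα0 hα hs hj h1 h2 h3
  | zero =>
    refine ⟨0, le_rfl, fun T lam X u _ x => ?_⟩
    simp [eLT2x]
  | add Φ Φ' hΦ hΦ' h h' =>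
    obtain ⟨C, hC, H⟩ := h
    obtain ⟨C', hC', H'⟩ := h'
    refine ⟨C + C', by positivity, fun T lam X u hu x => ?_⟩
    refine (eLT2x_add_le (hu.measurable_of_mem_jetSpan hΦ x)
      (hu.measurable_of_mem_jetSpan hΦ' x)).trans ((add_le_add (H T lam X u hu x)
        (H' T lam X u hu x)).trans_eq ?_)
    have hl := hu.lam_pos
    have hX := hu.X_pos
    have hx := jap_pos x
    rw [← ENNReal.ofReal_add (by positivity) (by positivity)]
    congr 1
    ring
  | smul c Φ _ h =>
    obtain ⟨C, hC, H⟩ := h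
    refine ⟨|c| * C, by positivity, fun T lam X u hu x => ?_⟩
    refine (eLT2x_le_mul (c := |c|) (G := fun t x => Φ (u t) x) fun t _ => by
      simp [abs_mul]).trans ((mul_le_mul_right (H T lam X u hu x) _).trans_eq ?_)
    rw [← ENNReal.ofReal_mul (abs_nonneg c)]
    congr 1
    ring

lemma contDiff_uncurry_iteratedDeriv {u : ℝ → ℝ → ℝ}
    (hu : ContDiff ℝ (⊤ : ℕ∞) (Function.uncurry u)) (d : ℕ) :
    ContDiff ℝ (⊤ : ℕ∞) (Function.uncurry fun t x => iteratedDeriv d (u t) x) := by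
  induction d with
  | zero => simpa using hu
  | succ d ih =>
    have h : (Function.uncurry fun t x => iteratedDeriv (d + 1) (u t) x) = fun p =>
        fderiv ℝ (Function.uncurry fun t x => iteratedDeriv d (u t) x) p (0, 1) := by
      ext ⟨t, x⟩
      have h1 : HasDerivAt (fun y : ℝ => (t, y)) ((0 : ℝ), (1 : ℝ)) x :=
        (hasDerivAt_const x t).prodMk (hasDerivAt_id x)
      have h2 := ((ih.differentiable (by simp)) (t, x)).hasFDerivAt.comp_hasDerivAt x h1
      simp only [Function.uncurry_apply_pair, iteratedDeriv_succ]
      exact h2.deriv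
    rw [h]
    exact (ih.fderiv_right (m := (⊤ : ℕ∞)) (by simp)).clm_apply contDiff_const

lemma contDiff_slice {u : ℝ → ℝ → ℝ} (hu : ContDiff ℝ (⊤ : ℕ∞) (Function.uncurry u)) (t : ℝ) :
    ContDiff ℝ (⊤ : ℕ∞) (u t) :=
  hu.comp (contDiff_prodMk_right t)

lemma contDiff_iteratedDeriv {f : ℝ → ℝ} (hf : ContDiff ℝ (⊤ : ℕ∞) f) (d : ℕ) :
    ContDiff ℝ (⊤ : ℕ∞) (iteratedDeriv d f) := by
  rw [iteratedDeriv_eq_iterate]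
  exact hf.iterate_deriv d

lemma iteratedDeriv_iteratedDeriv_add (f : ℝ → ℝ) (n d : ℕ) :
    iteratedDeriv n (iteratedDeriv d f) = iteratedDeriv (d + n) f := by
  simp only [iteratedDeriv_eq_iterate, add_comm d n, Function.iterate_add_apply]

lemma continuous_jap : Continuous jap := by
  unfold jap
  fun_prop

lemma jap_le_two_mul {x y : ℝ} (h1 : x ≤ y) (h2 : y ≤ x + 1) : jap x ≤ 2 * jap y := by
  rw [jap, jap, Real.sqrt_le_left (by positivity), mul_pow, Real.sq_sqrt (by positivity)]
  nlinarith [sq_nonneg (y + (y - x)), sq_nonneg y]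

lemma lintegral_enorm_sq_rpow_le_iff {β : Type*} [MeasurableSpace β] {μ : Measure β} {g : β → ℝ}
    {c : ℝ} (hc : 0 ≤ c) :
    (∫⁻ y, (‖g y‖₊ : ℝ≥0∞) ^ 2 ∂μ) ^ (1 / 2 : ℝ) ≤ ENNReal.ofReal c ↔
      ∫⁻ y, ENNReal.ofReal (g y ^ 2) ∂μ ≤ ENNReal.ofReal (c ^ 2) := by
  have h : ∀ y, (‖g y‖₊ : ℝ≥0∞) ^ 2 = ENNReal.ofReal (g y ^ 2) := fun y => by
    rw [← enorm_eq_nnnorm, Real.enorm_eq_ofReal_abs, ← ENNReal.ofReal_pow (abs_nonneg _), sq_abs]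
  simp_rw [h]
  rw [one_div, ENNReal.rpow_inv_le_iff two_pos, ENNReal.ofReal_rpow_of_nonneg hc two_pos.le,
    Real.rpow_two]

lemma eLT2x_le_iff {T c : ℝ} {F : ℝ → ℝ → ℝ} {x : ℝ} (hc : 0 ≤ c) :
    eLT2x T F x ≤ ENNReal.ofReal c ↔
      ∫⁻ t in Ioc 0 T, ENNReal.ofReal (F t x ^ 2) ≤ ENNReal.ofReal (c ^ 2) :=
  lintegral_enorm_sq_rpow_le_iff hc

lemma eL2_le_iff {c : ℝ} {g : ℝ → ℝ} (hc : 0 ≤ c) :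
    eL2 g ≤ ENNReal.ofReal c ↔
      ∫⁻ y, ENNReal.ofReal (g y ^ 2) ≤ ENNReal.ofReal (c ^ 2) := by
  rw [← lintegral_enorm_sq_rpow_le_iff hc, eL2,
    eLpNorm_eq_lintegral_rpow_enorm_toReal two_ne_zero ENNReal.ofNat_ne_top]
  simp [enorm_eq_nnnorm]

lemma ofReal_intervalIntegral_sq {g : ℝ → ℝ} (hg : Continuous g) {a b : ℝ} (hab : a ≤ b) :
    ENNReal.ofReal (∫ y in a..b, g y ^ 2) = ∫⁻ y in Ioc a b, ENNReal.ofReal (g y ^ 2) := by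
  rw [intervalIntegral.integral_of_le hab, ofReal_integral_eq_lintegral_ofReal]
  · exact ((hg.pow 2).intervalIntegrable a b).1
  · exact Eventually.of_forall fun y => sq_nonneg _

lemma intervalIntegral_sq_le_of_eL2_le {g : ℝ → ℝ} (hg : Continuous g) {c : ℝ} (hc : 0 ≤ c)
    (h : eL2 g ≤ ENNReal.ofReal c) {a b : ℝ} (hab : a ≤ b) :
    ∫ y in a..b, g y ^ 2 ≤ c ^ 2 := by
  rw [← ENNReal.ofReal_le_ofReal_iff (sq_nonneg c), ofReal_intervalIntegral_sq hg hab]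
  exact (lintegral_mono' Measure.restrict_le_self le_rfl).trans ((eL2_le_iff hc).1 h)

lemma intervalIntegral_sq_le_of_abs_le {g : ℝ → ℝ} (hg : Continuous g) {c a h : ℝ} (hh : 0 < h)
    (hb : ∀ y ∈ Icc a (a + h), |g y| ≤ c) :
    h⁻¹ * ∫ y in a..(a + h), g y ^ 2 ≤ c ^ 2 := by
  have h1 : ∫ y in a..(a + h), g y ^ 2 ≤ ∫ _ in a..(a + h), c ^ 2 :=
    intervalIntegral.integral_mono_on (by linarith) ((hg.pow 2).intervalIntegrable _ _) (by simp)
      fun y hy => sq_le_sq' (by linarith [neg_abs_le (g y), hb y hy])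
        (by linarith [le_abs_self (g y), hb y hy])
  rw [intervalIntegral.integral_const, smul_eq_mul, add_sub_cancel_left] at h1
  rw [inv_mul_le_iff₀ hh]
  exact h1

lemma abs_le_of_eLinf_le {g : ℝ → ℝ} (hg : Continuous g) {c : ℝ} (hc : 0 ≤ c)
    (h : eLinf g ≤ ENNReal.ofReal c) (x : ℝ) : |g x| ≤ c := by
  rw [eLinf, eLpNorm_exponent_top] at h
  by_contra! hx
  have hopen : IsOpen {y | c < |g y|} := isOpen_lt continuous_const hg.abs
  have hpos := hopen.measure_pos volume ⟨x, hx⟩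
  refine hpos.ne' (measure_mono_null (fun y hy => ?_)
    (ae_iff.1 (enorm_ae_le_eLpNormEssSup g volume)))
  simp only [mem_ofPred_eq, not_le] at hy ⊢
  refine h.trans_lt ?_
  rw [Real.enorm_eq_ofReal_abs]
  exact (ENNReal.ofReal_lt_ofReal_iff (hc.trans_lt hy)).2 hy

/-- The bounds on the individual norms contained in `‖u‖_{X_T} ≤ X`. -/
structure XTBounds (s j m : ℕ) (T X : ℝ) (u : ℝ → ℝ → ℝ) : Prop where
  smooth : ContDiff ℝ (⊤ : ℕ∞) (Function.uncurry u)
  nonneg : 0 ≤ X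
  sobolev : ∀ t ∈ Icc 0 T, ∀ k ≤ s, eL2 (iteratedDeriv k (u t)) ≤ ENNReal.ofReal X
  sup : ∀ t ∈ Icc 0 T, eLinf (fun x => jap x ^ m * u t x) ≤ ENNReal.ofReal X
  weighted : ∀ t ∈ Icc 0 T, ∀ k, 1 ≤ k → k ≤ 2 * j + 2 →
    eL2 (fun x => jap x ^ m * iteratedDeriv k (u t) x) ≤ ENNReal.ofReal X
  smoothing : ∀ x, ∀ l < j,
    eLT2x T (fun t x => iteratedDeriv (s + j - l) (u t) x) x ≤ ENNReal.ofReal X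

lemma xtBounds_of_ne_top {s j m : ℕ} {T : ℝ} {u : ℝ → ℝ → ℝ}
    (hu : ContDiff ℝ (⊤ : ℕ∞) (Function.uncurry u)) (h : XT s j m T u ≠ ⊤) :
    XTBounds s j m T (XT s j m T u).toReal u := by
  refine ⟨hu, ENNReal.toReal_nonneg, ?_, ?_, ?_, ?_⟩ <;> rw [ENNReal.ofReal_toReal h] <;>
    unfold XT
  · intro t ht k hk
    refine le_trans ?_ ((le_add_right le_rfl).trans ((le_add_right le_rfl).trans
      (le_add_right le_rfl)))
    refine le_trans ?_ (le_iSup (fun t : Icc (0 : ℝ) T => eHs s (u t)) ⟨t, ht⟩)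
    exact Finset.single_le_sum (f := fun k => eL2 (iteratedDeriv k (u t)))
      (fun _ _ => zero_le) (Finset.mem_range.2 (by omega))
  · intro t ht
    refine le_trans ?_ ((le_add_left le_rfl).trans ((le_add_right le_rfl).trans
      (le_add_right le_rfl)))
    exact le_iSup (fun t : Icc (0 : ℝ) T => eLinf (fun x => jap x ^ m * u t x)) ⟨t, ht⟩
  · intro t ht k hk1 hk2
    refine le_trans ?_ ((le_add_left le_rfl).trans (le_add_right le_rfl))
    refine le_trans ?_ (Finset.single_le_sum (f := fun γ => eLTinf T (fun t =>
      eL2 (fun x => jap x ^ m * iteratedDeriv γ (u t) x)))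
      (fun _ _ => zero_le) (Finset.mem_Icc.2 ⟨hk1, hk2⟩))
    exact le_iSup (fun t : Icc (0 : ℝ) T => eL2 (fun x => jap x ^ m * iteratedDeriv k (u t) x))
      ⟨t, ht⟩
  · intro x l hl
    refine le_trans ?_ (le_add_left le_rfl)
    refine le_trans ?_ (Finset.single_le_sum (f := fun l => eLxInfLT2 T (fun t x =>
      iteratedDeriv (s + j - l) (u t) x)) (fun _ _ => zero_le) (Finset.mem_range.2 hl))
    exact le_iSup (fun x => eLT2x T (fun t x => iteratedDeriv (s + j - l) (u t) x) x) x

/-- One-dimensional Sobolev inequality on unit intervals. -/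
lemma exists_sq_le_of_unit_interval : ∃ C : ℝ, 0 < C ∧ ∀ f : ℝ → ℝ, ContDiff ℝ (⊤ : ℕ∞) f →
    ∀ x, f x ^ 2 ≤
      C * ((∫ z in x..(x + 1), f z ^ 2) + ∫ z in x..(x + 1), iteratedDeriv 1 f z ^ 2) := by
  obtain ⟨C, hC, H⟩ := sq_iteratedDeriv_le (n := 1) (i := 0) one_pos
  refine ⟨C, hC, fun f hf x => ?_⟩
  simpa using H f hf x 1 one_pos

namespace XTBounds

variable {s j m : ℕ} {T X : ℝ} {u : ℝ → ℝ → ℝ}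

lemma exists_abs_iteratedDeriv_le (s j m : ℕ) : ∃ K : ℝ, 0 ≤ K ∧ ∀ (T X : ℝ) (u : ℝ → ℝ → ℝ),
    XTBounds s j m T X u → ∀ t ∈ Icc 0 T, ∀ x d, d + 1 ≤ s →
      |iteratedDeriv d (u t) x| ≤ K * X := by
  obtain ⟨C, hC, H⟩ := exists_sq_le_of_unit_interval
  refine ⟨√(2 * C), by positivity, fun T X u h t ht x d hd => ?_⟩
  have hsm := contDiff_slice h.smooth t
  have hf := contDiff_iteratedDeriv hsm d
  have h1 := H _ hf x
  rw [iteratedDeriv_iteratedDeriv_add] at h1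
  have i1 := intervalIntegral_sq_le_of_eL2_le hf.continuous h.nonneg
    (h.sobolev t ht d (by omega)) (show x ≤ x + 1 by linarith)
  have i2 := intervalIntegral_sq_le_of_eL2_le (contDiff_iteratedDeriv hsm (d + 1)).continuous
    h.nonneg (h.sobolev t ht (d + 1) hd) (show x ≤ x + 1 by linarith)
  refine abs_le_of_sq_le_sq ?_ (mul_nonneg (by positivity) h.nonneg)
  rw [mul_pow, Real.sq_sqrt (by positivity)]
  nlinarith

lemma exists_abs_iteratedDeriv_le_weight (s j m : ℕ) : ∃ K : ℝ, 0 ≤ K ∧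
    ∀ (T X : ℝ) (u : ℝ → ℝ → ℝ), XTBounds s j m T X u → ∀ t ∈ Icc 0 T, ∀ x d, 1 ≤ d →
      d ≤ 2 * j + 1 → |iteratedDeriv d (u t) x| ≤ K * X * (jap x ^ m)⁻¹ := by
  obtain ⟨C, hC, H⟩ := exists_sq_le_of_unit_interval
  refine ⟨√(2 * C) * 2 ^ m, by positivity, fun T X u h t ht x d hd1 hd2 => ?_⟩
  have hx := jap_pos x
  have hX := h.nonneg
  have hsm := contDiff_slice h.smooth t
  have key : ∀ k, 1 ≤ k → k ≤ 2 * j + 2 → (jap x ^ m) ^ 2 *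
      ∫ z in x..(x + 1), iteratedDeriv k (u t) z ^ 2 ≤ (2 ^ m * X) ^ 2 := by
    intro k hk1 hk2
    have hc : Continuous (iteratedDeriv k (u t)) := (contDiff_iteratedDeriv hsm k).continuous
    have hcj : Continuous fun z => jap z ^ m * iteratedDeriv k (u t) z :=
      (continuous_jap.pow m).mul hc
    have i1 := intervalIntegral_sq_le_of_eL2_le hcj hX (h.weighted t ht k hk1 hk2)
      (show x ≤ x + 1 by linarith)
    rw [mul_pow]
    refine le_trans ?_ (mul_le_mul_of_nonneg_left i1 (sq_nonneg _))
    rw [← intervalIntegral.integral_const_mul, ← intervalIntegral.integral_const_mul]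
    refine intervalIntegral.integral_mono_on (by linarith)
      (Continuous.intervalIntegrable (by fun_prop) _ _)
      (Continuous.intervalIntegrable (by fun_prop) _ _) fun z hz => ?_
    rw [mul_pow (jap z ^ m), ← mul_assoc, ← mul_pow (2 ^ m), ← mul_pow 2]
    have := jap_le_two_mul hz.1 hz.2
    gcongr
  have h1 := H _ (contDiff_iteratedDeriv hsm d) x
  rw [iteratedDeriv_iteratedDeriv_add] at h1
  have k1 := key d hd1 (by omega)
  have k2 := key (d + 1) (by omega) (by omega)
  rw [← div_eq_mul_inv, le_div_iff₀ (by positivity), mul_comm, ← abs_of_pos (pow_pos hx m),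
    ← abs_mul]
  refine abs_le_of_sq_le_sq ?_ (by positivity)
  rw [mul_assoc, mul_pow, mul_pow √(2 * C), Real.sq_sqrt (by positivity)]
  calc (jap x ^ m) ^ 2 * iteratedDeriv d (u t) x ^ 2
      ≤ (jap x ^ m) ^ 2 * (C * ((∫ z in x..(x + 1), iteratedDeriv d (u t) z ^ 2)
        + ∫ z in x..(x + 1), iteratedDeriv (d + 1) (u t) z ^ 2)) := by gcongr
    _ = C * ((jap x ^ m) ^ 2 * (∫ z in x..(x + 1), iteratedDeriv d (u t) z ^ 2)
        + (jap x ^ m) ^ 2 * ∫ z in x..(x + 1), iteratedDeriv (d + 1) (u t) z ^ 2) := by ring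
    _ ≤ C * ((2 ^ m * X) ^ 2 + (2 ^ m * X) ^ 2) := by gcongr
    _ = _ := by ring

/-- Weighted interpolation between the weighted low order bounds and the unweighted bounds of
order `s - 1`. -/
lemma exists_abs_iteratedDeriv_le_interpolated {s j : ℕ} (m : ℕ) (hs : 2 * j + 3 ≤ s) {d : ℕ}
    (hd1 : 1 ≤ d) (hds : d ≤ s - 1) : ∃ K : ℝ, 0 ≤ K ∧
    ∀ (T X : ℝ) (u : ℝ → ℝ → ℝ), XTBounds s j m T X u → ∀ t ∈ Icc 0 T, ∀ x,
      |iteratedDeriv d (u t) x| ≤ K * X *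
        jap x ^ (-(m : ℝ) + m / (s - 2 * j - 2 : ℝ) * ((d - (2 * j + 1) : ℕ) : ℝ)) := by
  obtain ⟨K₁, hK₁, H₁⟩ := exists_abs_iteratedDeriv_le s j m
  obtain ⟨K₂, hK₂, H₂⟩ := exists_abs_iteratedDeriv_le_weight s j m
  rcases le_or_gt d (2 * j + 1) with hd | hd
  · refine ⟨K₂, hK₂, fun T X u h t ht x => ?_⟩
    rw [Nat.sub_eq_zero_of_le hd, Nat.cast_zero, mul_zero, add_zero, Real.rpow_neg (jap_pos x).le,
      Real.rpow_natCast]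
    exact H₂ T X u h t ht x d hd1 hd
  obtain ⟨n, rfl⟩ : ∃ n, s = 2 * j + 2 + n := ⟨s - (2 * j + 2), by omega⟩
  obtain ⟨i, rfl⟩ : ∃ i, d = 2 * j + 1 + i := ⟨d - (2 * j + 1), by omega⟩
  have hn : (n : ℝ) ≠ 0 := by
    have : n ≠ 0 := by omega
    exact_mod_cast this
  have hcast : (((2 * j + 2 + n : ℕ) : ℝ) - 2 * j - 2) = n := by push_cast; ring
  rw [hcast, Nat.add_sub_cancel_left]
  rcases (show i ≤ n by omega).eq_or_lt with rfl | hin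
  · refine ⟨K₁, hK₁, fun T X u h t ht x => ?_⟩
    rw [div_mul_cancel₀ _ hn, neg_add_cancel, Real.rpow_zero, mul_one]
    exact H₁ T X u h t ht x _ (by omega)
  obtain ⟨C, hC, H⟩ := sq_iteratedDeriv_le hin
  refine ⟨√(C * ((K₂ * 2 ^ m) ^ 2 + K₁ ^ 2)), by positivity, fun T X u h t ht x => ?_⟩
  have hx := jap_pos x
  have hX := h.nonneg
  have hsm := contDiff_slice h.smooth t
  have hf := contDiff_iteratedDeriv hsm (2 * j + 1)
  set η := jap x ^ (-((m : ℝ) / n)) with hη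
  have hη0 : 0 < η := by positivity
  have hη1 : η ≤ 1 := Real.rpow_le_one_of_one_le_of_nonpos (one_le_jap x)
    (neg_nonpos.2 (by positivity))
  have hηn : η ^ n = (jap x ^ m)⁻¹ := by
    rw [hη, ← Real.rpow_natCast, ← Real.rpow_mul hx.le, neg_mul, div_mul_cancel₀ _ hn,
      Real.rpow_neg hx.le, Real.rpow_natCast]
  have hηi : jap x ^ (-(m : ℝ) + m / n * i) = (jap x ^ m)⁻¹ * (η ^ i)⁻¹ := by
    have hpow : η ^ i = jap x ^ (-((m : ℝ) / n) * i) := by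
      rw [hη, ← Real.rpow_natCast, ← Real.rpow_mul hx.le]
    rw [Real.rpow_add hx, Real.rpow_neg hx.le (m : ℝ), Real.rpow_natCast, hpow, neg_mul,
      Real.rpow_neg hx.le, inv_inv]
  have h1 := H _ hf x η hη0
  rw [iteratedDeriv_iteratedDeriv_add, iteratedDeriv_iteratedDeriv_add] at h1
  have i1 := intervalIntegral_sq_le_of_abs_le (c := K₂ * X * (2 ^ m * (jap x ^ m)⁻¹))
    hf.continuous hη0 (a := x) fun y hy => by
      refine (H₂ T X u h t ht y _ (by omega) le_rfl).trans ?_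
      have hy0 := jap_pos y
      have := jap_le_two_mul hy.1 (hy.2.trans (by linarith))
      gcongr
      rw [inv_le_iff_one_le_mul₀ (by positivity), mul_assoc, inv_mul_eq_div, ← mul_div_assoc,
        one_le_div (by positivity), ← mul_pow]
      gcongr
  have i2 := intervalIntegral_sq_le_of_abs_le (c := K₁ * X)
    (contDiff_iteratedDeriv hsm (2 * j + 1 + n)).continuous hη0 (a := x) fun y _ =>
      H₁ T X u h t ht y _ (by omega)
  rw [hηi, ← mul_assoc, ← div_eq_mul_inv, le_div_iff₀ (by positivity), mul_comm,
    ← abs_of_pos (pow_pos hη0 i), ← abs_mul]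
  refine abs_le_of_sq_le_sq ?_ (by positivity)
  rw [mul_pow, mul_pow _ (jap x ^ m)⁻¹, mul_pow _ X, Real.sq_sqrt (by positivity)]
  rw [mul_comm 2 n, pow_mul, hηn] at h1
  calc (η ^ i) ^ 2 * iteratedDeriv (2 * j + 1 + i) (u t) x ^ 2
      = (η ^ i * iteratedDeriv (2 * j + 1 + i) (u t) x) ^ 2 := by ring
    _ ≤ C * ((K₂ * X * (2 ^ m * (jap x ^ m)⁻¹)) ^ 2 + (jap x ^ m)⁻¹ ^ 2 * (K₁ * X) ^ 2) :=
        h1.trans (by gcongr)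
    _ = _ := by ring

lemma lintegral_intervalIntegral_sq_le (h : XTBounds s j m T X u) (hj : 1 ≤ j) (x : ℝ)
    {η : ℝ} (hη : 0 < η) :
    ∫⁻ t in Ioc 0 T, ENNReal.ofReal (∫ y in x..(x + η), iteratedDeriv (s + j) (u t) y ^ 2)
      ≤ ENNReal.ofReal (η * X ^ 2) := by
  have hc := (contDiff_uncurry_iteratedDeriv h.smooth (s + j)).continuous
  have h1 : ∀ t, ENNReal.ofReal (∫ y in x..(x + η), iteratedDeriv (s + j) (u t) y ^ 2)
      = ∫⁻ y in Ioc x (x + η), ENNReal.ofReal (iteratedDeriv (s + j) (u t) y ^ 2) := fun t =>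
    ofReal_intervalIntegral_sq
      (contDiff_iteratedDeriv (contDiff_slice h.smooth t) (s + j)).continuous (by linarith)
  simp_rw [h1]
  rw [lintegral_lintegral_swap
    (f := fun t y => ENNReal.ofReal (iteratedDeriv (s + j) (u t) y ^ 2))
    (ENNReal.measurable_ofReal.comp (hc.measurable.pow_const 2)).aemeasurable]
  calc _ ≤ ∫⁻ _ in Ioc x (x + η), ENNReal.ofReal (X ^ 2) :=
        lintegral_mono fun y => (eLT2x_le_iff h.nonneg).1 (h.smoothing y 0 hj)
    _ = _ := by
      rw [lintegral_const, Measure.restrict_apply_univ, Real.volume_Ioc, add_sub_cancel_left,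
        mul_comm, ← ENNReal.ofReal_mul hη.le]

/-- Interpolation of the local smoothing norm between the orders `s - 1` and `s + j`. -/
lemma exists_eLT2x_iteratedDeriv_le {s j : ℕ} (m : ℕ) (hs : 1 ≤ s) (hj : 1 ≤ j) {i : ℕ}
    (hij : i ≤ j) : ∃ K : ℝ, 0 ≤ K ∧
    ∀ (T X : ℝ) (u : ℝ → ℝ → ℝ), 0 ≤ T → XTBounds s j m T X u → ∀ η : ℝ, 0 < η → ∀ x,
      eLT2x T (fun t x => iteratedDeriv (s - 1 + i) (u t) x) x ≤
        ENNReal.ofReal (K * (η⁻¹ ^ i * (√T * X) + η ^ (j + 1 - i) * X)) := by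
  obtain ⟨K₁, hK₁, H₁⟩ := exists_abs_iteratedDeriv_le s j m
  obtain ⟨C, hC, H⟩ := sq_iteratedDeriv_le (n := j + 1) (i := i) (by omega)
  refine ⟨√C * (K₁ + 1), by positivity, fun T X u hT h η hη x => ?_⟩
  have hX := h.nonneg
  rw [eLT2x_le_iff (by positivity)]
  have hpt : ∀ t ∈ Ioc 0 T, ENNReal.ofReal (iteratedDeriv (s - 1 + i) (u t) x ^ 2) ≤
      ENNReal.ofReal (C * η⁻¹ ^ (2 * i) * (K₁ * X) ^ 2)
      + ENNReal.ofReal (C * η⁻¹ ^ (2 * i) * (η ^ (2 * (j + 1)) * η⁻¹)) *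
        ENNReal.ofReal (∫ y in x..(x + η), iteratedDeriv (s + j) (u t) y ^ 2) := by
    intro t ht
    have hsm := contDiff_slice h.smooth t
    have hf := contDiff_iteratedDeriv hsm (s - 1)
    have h1 := H _ hf x η hη
    rw [iteratedDeriv_iteratedDeriv_add, iteratedDeriv_iteratedDeriv_add,
      show s - 1 + (j + 1) = s + j by omega] at h1
    have i1 := intervalIntegral_sq_le_of_abs_le (c := K₁ * X) hf.continuous hη (a := x)
      fun y _ => H₁ T X u h t ⟨ht.1.le, ht.2⟩ y _ (by omega)
    have i2 : 0 ≤ ∫ y in x..(x + η), iteratedDeriv (s + j) (u t) y ^ 2 :=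
      intervalIntegral.integral_nonneg (by linarith) fun y _ => sq_nonneg _
    rw [← ENNReal.ofReal_mul (by positivity), ← ENNReal.ofReal_add (by positivity)
      (by positivity)]
    refine ENNReal.ofReal_le_ofReal ?_
    calc iteratedDeriv (s - 1 + i) (u t) x ^ 2
        = η⁻¹ ^ (2 * i) * (η ^ i * iteratedDeriv (s - 1 + i) (u t) x) ^ 2 := by
          rw [inv_pow, mul_pow, ← pow_mul, mul_comm i 2]
          field_simp
      _ ≤ η⁻¹ ^ (2 * i) * (C * ((K₁ * X) ^ 2 + η ^ (2 * (j + 1)) *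
          (η⁻¹ * ∫ y in x..(x + η), iteratedDeriv (s + j) (u t) y ^ 2))) := by
          gcongr
          exact h1.trans (by gcongr)
      _ = _ := by ring
  refine (setLIntegral_mono' measurableSet_Ioc hpt).trans ?_
  rw [lintegral_add_left measurable_const, lintegral_const_mul' _ _ ENNReal.ofReal_ne_top,
    lintegral_const, Measure.restrict_apply_univ, Real.volume_Ioc, sub_zero]
  refine (add_le_add_right (mul_le_mul_right
    (h.lintegral_intervalIntegral_sq_le hj x hη) _) _).trans ?_
  rw [← ENNReal.ofReal_mul (by positivity), ← ENNReal.ofReal_mul (by positivity),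
    ← ENNReal.ofReal_add (by positivity) (by positivity)]
  refine ENNReal.ofReal_le_ofReal ?_
  have e1 : C * η⁻¹ ^ (2 * i) * (K₁ * X) ^ 2 * T = C * (K₁ * (η⁻¹ ^ i * (√T * X))) ^ 2 := by
    rw [mul_pow K₁ (_ * _), mul_pow (η⁻¹ ^ i), mul_pow √T, Real.sq_sqrt hT]
    ring
  have e2 : C * η⁻¹ ^ (2 * i) * (η ^ (2 * (j + 1)) * η⁻¹) * (η * X ^ 2)
      = C * (η ^ (j + 1 - i) * X) ^ 2 := by
    obtain ⟨k, hk⟩ : ∃ k, j + 1 = i + k := Nat.exists_eq_add_of_le (by omega)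
    rw [hk, Nat.add_sub_cancel_left, inv_pow]
    field_simp
    ring
  rw [e1, e2, mul_pow (√C * (K₁ + 1)), mul_pow √C, Real.sq_sqrt hC.le]
  set a := η⁻¹ ^ i * (√T * X)
  set b := η ^ (j + 1 - i) * X
  have ha : 0 ≤ a := by positivity
  have hb : 0 ≤ b := by positivity
  calc C * (K₁ * a) ^ 2 + C * b ^ 2 ≤ C * ((K₁ * a) ^ 2 + b ^ 2 + 2 * (K₁ * a) * b) := by
        have : 0 ≤ C * (2 * (K₁ * a) * b) := by positivity
        linarith
    _ = C * (K₁ * a + b) ^ 2 := by ring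
    _ ≤ C * ((K₁ + 1) * (a + b)) ^ 2 := by
      gcongr
      nlinarith [mul_nonneg hK₁ hb]
    _ = _ := by ring

lemma exists_jetBounds {s j : ℕ} (m : ℕ) (hs : 5 * j + 1 ≤ s) (hj : 1 ≤ j) :
    ∃ K : ℝ, 0 ≤ K ∧ ∀ (T lam X : ℝ) (u : ℝ → ℝ → ℝ), 0 < T → 0 < lam →
      XTBounds s j m T X u → (∀ t ∈ Icc 0 T, ∀ x, lam / 2 ≤ jap x ^ m * |u t x|) →
        JetBounds s j m K T lam X u := by
  have hlow : ∀ d : ℕ, ∃ K : ℝ, 0 ≤ K ∧ (1 ≤ d → d ≤ s - 1 →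
      ∀ (T X : ℝ) (u : ℝ → ℝ → ℝ), XTBounds s j m T X u → ∀ t ∈ Icc 0 T, ∀ x,
      |iteratedDeriv d (u t) x| ≤ K * X *
        jap x ^ (-(m : ℝ) + m / (s - 2 * j - 2 : ℝ) * ((d - (2 * j + 1) : ℕ) : ℝ))) := by
    intro d
    by_cases hd : 1 ≤ d ∧ d ≤ s - 1
    · obtain ⟨K, hK, H⟩ := exists_abs_iteratedDeriv_le_interpolated m
        (show 2 * j + 3 ≤ s by omega) hd.1 hd.2
      exact ⟨K, hK, fun _ _ => H⟩
    · exact ⟨0, le_rfl, fun h1 h2 => absurd ⟨h1, h2⟩ hd⟩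
  have hhigh : ∀ i : ℕ, ∃ K : ℝ, 0 ≤ K ∧ (i ≤ j →
      ∀ (T X : ℝ) (u : ℝ → ℝ → ℝ), 0 ≤ T → XTBounds s j m T X u → ∀ η : ℝ, 0 < η → ∀ x,
      eLT2x T (fun t x => iteratedDeriv (s - 1 + i) (u t) x) x ≤
        ENNReal.ofReal (K * (η⁻¹ ^ i * (√T * X) + η ^ (j + 1 - i) * X))) := by
    intro i
    by_cases hi : i ≤ j
    · obtain ⟨K, hK, H⟩ := exists_eLT2x_iteratedDeriv_le m (show 1 ≤ s by omega) hj hi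
      exact ⟨K, hK, fun _ => H⟩
    · exact ⟨0, le_rfl, fun h => absurd h hi⟩
  choose K₁ hK₁ H₁ using hlow
  choose K₂ hK₂ H₂ using hhigh
  have hS₁ : 0 ≤ ∑ d ∈ Finset.range s, K₁ d := Finset.sum_nonneg fun d _ => hK₁ d
  have hS₂ : 0 ≤ ∑ i ∈ Finset.range (j + 1), K₂ i := Finset.sum_nonneg fun d _ => hK₂ d
  refine ⟨(∑ d ∈ Finset.range s, K₁ d) + ∑ i ∈ Finset.range (j + 1), K₂ i, by positivity,
    fun T lam X u hT hl h hlower => ?_⟩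
  have hup : ∀ t ∈ Icc 0 T, ∀ x, jap x ^ m * |u t x| ≤ X := fun t ht x => by
    have := abs_le_of_eLinf_le
      ((continuous_jap.pow m).mul (contDiff_slice h.smooth t).continuous) h.nonneg
      (h.sup t ht) x
    rwa [Pi.mul_apply, Pi.pow_apply, abs_mul, abs_of_pos (pow_pos (jap_pos x) m)] at this
  have hlX : lam ≤ 2 * X := by
    have h0 : (0 : ℝ) ∈ Icc 0 T := ⟨le_rfl, hT.le⟩
    linarith [hlower 0 h0 0, hup 0 h0 0]
  have hX : 0 < X := by linarith
  refine ⟨hl, hlX, fun d x => ?_, fun t ht => hlower t (Ioc_subset_Icc_self ht),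
    fun t ht => hup t (Ioc_subset_Icc_self ht), fun t ht x d hd1 hd2 => ?_,
    fun x i _ hi => ?_, fun x => h.smoothing x 0 hj⟩
  · exact ((contDiff_uncurry_iteratedDeriv h.smooth d).continuous.comp
      (Continuous.prodMk_left x)).measurable
  · refine (H₁ d hd1 hd2 T X u h t (Ioc_subset_Icc_self ht) x).trans ?_
    have := Finset.single_le_sum (fun d _ => hK₁ d) (Finset.mem_range.2 (show d < s by omega))
    have hx := jap_pos x
    gcongr
    linarith
  · refine (H₂ i hi T X u hT.le h (lam / X) (by positivity) x).trans
      (ENNReal.ofReal_le_ofReal ?_)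
    have := Finset.single_le_sum (fun d _ => hK₂ d)
      (Finset.mem_range.2 (show i < j + 1 by omega))
    rw [inv_div]
    gcongr
    linarith

end XTBounds

lemma lintegral_jap_rpow_neg_ne_top {r : ℝ} (hr : 1 < r) :
    ∫⁻ x : ℝ, ENNReal.ofReal (jap x ^ (-r)) ≠ ⊤ := by
  have h := integrable_rpow_neg_one_add_norm_sq (E := ℝ) (μ := volume) (r := r) (by simpa using hr)
  refine (lintegral_congr fun x => ?_).trans_ne h.lintegral_lt_top.ne
  rw [Real.norm_eq_abs, sq_abs, jap, Real.sqrt_eq_rpow, ← Real.rpow_mul (by positivity)]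
  congr 2
  ring

lemma eLxqLT2_le_of_decay {q T r B : ℝ} {F : ℝ → ℝ → ℝ} (hq : 0 < q)
    (h : ∀ x, eLT2x T F x ≤ ENNReal.ofReal (jap x ^ (-r) * B)) :
    eLxqLT2 q T F ≤
      (∫⁻ x : ℝ, ENNReal.ofReal (jap x ^ (-(r * q)))) ^ (1 / q) * ENNReal.ofReal B := by
  have hpt : ∀ x, eLT2x T F x ^ q ≤
      ENNReal.ofReal (jap x ^ (-(r * q))) * ENNReal.ofReal B ^ q := fun x => by
    have hx := jap_pos x
    refine (ENNReal.rpow_le_rpow (h x) hq.le).trans_eq ?_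
    rw [ENNReal.ofReal_mul (by positivity), ENNReal.mul_rpow_of_nonneg _ _ hq.le,
      ENNReal.ofReal_rpow_of_pos (by positivity), ← Real.rpow_mul hx.le, neg_mul]
  refine (ENNReal.rpow_le_rpow (lintegral_mono hpt) (by positivity)).trans_eq ?_
  rw [lintegral_mul_const' _ _ (ENNReal.rpow_ne_top_of_nonneg hq.le ENNReal.ofReal_ne_top),
    ENNReal.mul_rpow_of_nonneg _ _ (by positivity), ← ENNReal.rpow_mul, mul_one_div_cancel hq.ne',
    ENNReal.rpow_one]

/-- **Nonlinear estimate (3.2)**: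
`‖∂_x^{s-j+1}(|u|^α ∂_x^{2j-1} u)‖_{L_x^q L_T^2}
  ≤ C ‖u‖_{X_T}^{α+1} + C T^{1/2} λ^{α-1} ‖u‖_{X_T}^2 + C T^{1/2} λ^{α-(s-j+1)} ‖u‖_{X_T}^{s-j+2}`. -/
theorem nonlinear_estimate_32 (α : ℝ) (hα : α ∈ Set.Ioo (0:ℝ) 1) (m : ℕ)
    (hm : m = ⌊1 / α⌋₊ + 1) (s j : ℕ) (hj : 1 ≤ j) (hjs : j ≤ s)
    (hs : (s : ℝ) - 1 ≥ (2 / α) * j + 3 * j) (q : ℝ) (hq : q ∈ Set.Ioc (1:ℝ) 2) :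
    ∃ C : ℝ, 0 < C ∧ ∀ T : ℝ, 0 < T → ∀ lam : ℝ, 0 < lam → ∀ u : ℝ → ℝ → ℝ,
      ContDiff ℝ (⊤ : ℕ∞) (Function.uncurry u) →
      (∀ t ∈ Set.Icc (0:ℝ) T, ∀ x : ℝ, lam / 2 ≤ jap x ^ m * |u t x|) →
      eLxqLT2 q T (fun t x => iteratedDeriv (s - j + 1) (nonlin α j u t) x)
        ≤ ENNReal.ofReal C * XT s j m T u ^ (α + 1)
          + ENNReal.ofReal (C * Real.sqrt T * lam ^ (α - 1)) * XT s j m T u ^ (2 : ℝ)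
          + ENNReal.ofReal (C * Real.sqrt T * lam ^ (α - ((s : ℝ) - j + 1)))
              * XT s j m T u ^ ((s : ℝ) - j + 2) := by
  obtain ⟨hα0, hα1⟩ := hα
  have hq1 : 1 < q := hq.1
  have hq0 : 0 < q := by linarith
  have hj1 : (1 : ℝ) ≤ j := by exact_mod_cast hj
  have hsj : 5 * j + 1 ≤ s := by
    have h2 : 2 ≤ 2 / α := by
      rw [le_div_iff₀ hα0]
      linarith
    have : (5 * j + 1 : ℝ) ≤ s := by nlinarith
    exact_mod_cast this
  have hmα : 1 < m * α := by
    rw [← div_lt_iff₀ hα0, hm]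
    exact_mod_cast Nat.lt_floor_add_one (1 / α)
  obtain ⟨Φ, hΦ, hΦeq⟩ :=
    exists_iteratedDeriv_nonlin_eq α (p := 2 * j - 1) (by omega) (s - j + 1)
  rw [show 2 * j - 1 + (s - j + 1) = s + j by omega, add_assoc, one_add_one_eq_two] at hΦ
  obtain ⟨K, hK, hjet⟩ := XTBounds.exists_jetBounds m hsj hj
  obtain ⟨C₀, hC₀, hest⟩ := exists_eLT2x_jetSpan_le m hK hα0.le hα1 hsj hj hΦ
  obtain ⟨D, hD, hI⟩ : ∃ D : ℝ, 0 ≤ D ∧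
      (∫⁻ x : ℝ, ENNReal.ofReal (jap x ^ (-(m * α * q)))) ^ (1 / q) = ENNReal.ofReal D :=
    ⟨_, ENNReal.toReal_nonneg, (ENNReal.ofReal_toReal
      (ENNReal.rpow_ne_top_of_nonneg (by positivity)
        (lintegral_jap_rpow_neg_ne_top (by nlinarith)))).symm⟩
  have hC : 0 < D * C₀ + 1 := by positivity
  refine ⟨D * C₀ + 1, hC, fun T hT lam hlam u hu hlow => ?_⟩
  rcases eq_or_ne (XT s j m T u) ⊤ with htop | htop
  · rw [htop, ENNReal.top_rpow_of_pos (by linarith),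
      ENNReal.mul_top (ENNReal.ofReal_pos.2 hC).ne', top_add, top_add]
    exact le_top
  have hXT := ENNReal.ofReal_toReal htop
  have hb := hjet T lam _ u hT hlam (xtBounds_of_ne_top hu htop) hlow
  set X := (XT s j m T u).toReal
  have hX : 0 < X := hb.X_pos
  have hN : ((s - j + 1 : ℕ) : ℝ) = (s : ℝ) - j + 1 := by
    rw [Nat.cast_succ, Nat.cast_sub hjs]
  have hdec : ∀ x, eLT2x T (fun t x => iteratedDeriv (s - j + 1) (nonlin α j u t) x) x ≤
      ENNReal.ofReal (jap x ^ (-(m * α)) *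
        (C₀ * (X ^ (α + 1) + √T * (lam ^ (α - (s - j + 1 : ℕ)) * X ^ (s - j + 1 + 1))))) := by
    intro x
    rw [← mul_assoc]
    refine le_trans ?_ (hest T lam X u hb x)
    refine (eLT2x_le_mul (c := 1) (G := fun t x => Φ (u t) x) fun t ht => ?_).trans_eq
      (by rw [ENNReal.ofReal_one, one_mul])
    rw [one_mul]
    exact (congrArg abs (congrFun (hΦeq (u t) (contDiff_slice hu t) (hb.ne_zero ht)) x)).le
  refine (eLxqLT2_le_of_decay hq0 hdec).trans ?_
  have hpow : X ^ (s - j + 1 + 1) = X ^ ((s : ℝ) - j + 2) := by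
    rw [← Real.rpow_natCast, Nat.cast_succ, hN]
    congr 1
    ring
  rw [hI, ← ENNReal.ofReal_mul hD, hN, hpow,
    ← hXT, ENNReal.ofReal_rpow_of_pos hX, ENNReal.ofReal_rpow_of_pos hX,
    ENNReal.ofReal_rpow_of_pos hX, ← ENNReal.ofReal_mul hC.le,
    ← ENNReal.ofReal_mul (by positivity), ← ENNReal.ofReal_mul (by positivity),
    ← ENNReal.ofReal_add (by positivity) (by positivity),
    ← ENNReal.ofReal_add (by positivity) (by positivity)]
  refine ENNReal.ofReal_le_ofReal ?_
  have ha : 0 ≤ X ^ (α + 1) := by positivity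
  have hb' : 0 ≤ √T * lam ^ (α - ((s : ℝ) - j + 1)) * X ^ ((s : ℝ) - j + 2) := by positivity
  have hc : 0 ≤ (D * C₀ + 1) * √T * lam ^ (α - 1) * X ^ (2 : ℝ) := by positivity
  nlinarith
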